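/- Let (M,F) be a Finsler manifold, IM its indicatrix bundle with restricted Sasaki metric Ḡ and induced Levi-Civita connection ∇̄, and ∇ the Levi-Civita connection of the Sasaki metric G on TM with curvature tensor R. Then the curvature tensors are related by R(∂̄/∂̄y^a, ∂̄/∂̄y^b)∂̄/∂̄y^c = R̄(∂̄/∂̄y^a, ∂̄/∂̄y^b)∂̄/∂̄y^c − (1/F²) g_{bc} ∂̄/∂̄y^a + (1/F²) g_{ac} ∂̄/∂̄y^b, and R(δ̄/δ̄x^a, δ̄/δ̄x^b)∂̄/∂̄y^c = R̄(δ̄/δ̄x^a, δ̄/δ̄x^b)∂̄/∂̄y^c + (1/F²) R_{cab} L, where R̄ is the curvature of ∇̄; for all frame pairs other than those listed in equation (9) of the paper the two curvature tensors agree. -/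

import Mathlib

/-!
A local-coordinate framework for the geometry of the tangent bundle `TM` of an
`n`-dimensional Finsler manifold `(M, F)`, following the paper
"A frame on tangent bundle of a Finsler manifold and the natural foliations".

All geometric objects are described through their components on a chart domain
`U` of `TM` (avoiding the zero section): a point `p : Pt n` is the pair of
coordinates `(x^i, y^i)`, and a vector field on `TM` is given by its
components in the natural frame `(∂/∂x^i, ∂/∂y^i)`.
-/

open scoped BigOperators

noncomputable section

namespace FinslerFoliations

/-- A point of the tangent bundle `TM` in local coordinates:
`p.1 = (x^i)` is the base point and `p.2 = (y^i)` is the fibre coordinate. -/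
abbrev Pt (n : ℕ) : Type := (Fin n → ℝ) × (Fin n → ℝ)

/-- A (local) vector field on `TM`, given by its components in the natural
frame: `(X p).1 i` is the coefficient of `∂/∂x^i` and `(X p).2 i` the one of
`∂/∂y^i`. -/
abbrev VF (n : ℕ) : Type := Pt n → Pt n

variable {n : ℕ}

/-- The coordinate vector `∂/∂x^i`. -/
def ex (i : Fin n) : Pt n := (Pi.single i 1, 0)

/-- The coordinate vector `∂/∂y^i`. -/
def ey (i : Fin n) : Pt n := (0, Pi.single i 1)

/-- Partial derivative of a scalar function in the constant direction `v`. -/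
def pd (v : Pt n) (f : Pt n → ℝ) (p : Pt n) : ℝ := fderiv ℝ f p v

/-- Derivative of a scalar function along a vector field. -/
def Dv (X : VF n) (f : Pt n → ℝ) (p : Pt n) : ℝ := fderiv ℝ f p (X p)

/-- The Lie bracket of two vector fields, in coordinates. -/
def lie (X Y : VF n) : VF n := fun p => fderiv ℝ Y p (X p) - fderiv ℝ X p (Y p)

/-- Local-coordinate data of an `n`-dimensional Finsler manifold `(M, F)` on a
chart domain `U ⊆ TM` avoiding the zero section: the fundamental function `F`
(smooth, positive and positively `1`-homogeneous in `y`), the fundamental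
tensor `g_{ij} = ½ ∂²F²/∂y^i∂y^j` (symmetric and positive definite) with its
inverse `g^{ij}`, the spray coefficients
`G^i = (g^{ij}/4)(∂²F²/∂y^j∂x^k y^k − ∂F²/∂x^j)` and the nonlinear connection
coefficients `G_i^j = ∂G^j/∂y^i`. -/
structure Chart (n : ℕ) : Type where
  /-- the chart domain in `TM` -/
  U : Set (Pt n)
  hUopen : IsOpen U
  hUslit : ∀ p ∈ U, p.2 ≠ 0
  /-- the fundamental function `F` -/
  F : Pt n → ℝ
  Fpos : ∀ p ∈ U, 0 < F p
  Fsmooth : ContDiffOn ℝ (⊤ : ℕ∞) F U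
  Fhomog : ∀ p ∈ U, ∀ t : ℝ, 0 < t → (p.1, t • p.2) ∈ U →
    F (p.1, t • p.2) = t * F p
  /-- the fundamental tensor `g_{ij}` -/
  g : Fin n → Fin n → Pt n → ℝ
  gdef : ∀ i j, ∀ p ∈ U,
    g i j p = (1/2) * pd (ey i) (pd (ey j) (fun q => F q ^ 2)) p
  gsmooth : ∀ i j, ContDiffOn ℝ (⊤ : ℕ∞) (g i j) U
  gsymm : ∀ i j, ∀ p ∈ U, g i j p = g j i p
  gposdef : ∀ p ∈ U, ∀ v : Fin n → ℝ, v ≠ 0 →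
    0 < ∑ i, ∑ j, g i j p * v i * v j
  /-- the inverse `g^{ij}` of the fundamental tensor -/
  ginv : Fin n → Fin n → Pt n → ℝ
  hginv : ∀ i j, ∀ p ∈ U,
    (∑ k, g i k p * ginv k j p) = if i = j then (1:ℝ) else 0
  /-- the spray coefficients `G^i` -/
  spray : Fin n → Pt n → ℝ
  spraydef : ∀ i, ∀ p ∈ U, spray i p = (1/4) * ∑ j, ginv i j p *
      ((∑ k, pd (ey j) (pd (ex k) (fun q => F q ^ 2)) p * p.2 k)
        - pd (ex j) (fun q => F q ^ 2) p)
  /-- the nonlinear connection coefficients `G_i^j` -/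
  N : Fin n → Fin n → Pt n → ℝ
  Ndef : ∀ i j, ∀ p ∈ U, N i j p = pd (ey i) (spray j) p
  Nsmooth : ∀ i j, ContDiffOn ℝ (⊤ : ℕ∞) (N i j) U

variable (fc : Chart n)

/-- the vertical frame field `∂/∂y^i`. -/
def dyv (i : Fin n) : VF n := fun _ => ey i

/-- the horizontal frame field `δ/δx^i = ∂/∂x^i − G_i^j ∂/∂y^j`. -/
def ddx (i : Fin n) : VF n := fun p => (Pi.single i 1, fun j => -(fc.N i j p))

/-- the vertical Liouville vector field `L = y^i ∂/∂y^i`. -/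
def LV : VF n := fun p => ((0 : Fin n → ℝ), p.2)

/-- the horizontal Liouville vector field `ξ = y^i δ/δx^i`. -/
def XI : VF n := fun p => (p.2, fun j => -(∑ i, p.2 i * fc.N i j p))

/-- the dual coframe `δy^i = dy^i + G_j^i dx^j`, applied to a tangent vector. -/
def dely (i : Fin n) (p : Pt n) (v : Pt n) : ℝ := v.2 i + ∑ j, fc.N j i p * v.1 j

/-- the Sasaki lifted metric `G = g_{ij} dx^i ⊗ dx^j + g_{ij} δy^i ⊗ δy^j`. -/
def Gs (p : Pt n) (v w : Pt n) : ℝ :=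
  ∑ i, ∑ j, fc.g i j p * (v.1 i * w.1 j + dely fc i p v * dely fc j p w)

/-- the natural almost complex structure
`J = δ/δx^i ⊗ δy^i − ∂/∂y^i ⊗ dx^i`, as a pointwise endomorphism. -/
def Jm (p : Pt n) (v : Pt n) : Pt n :=
  (fun i => dely fc i p v,
   fun k => -(∑ i, dely fc i p v * fc.N i k p) - v.1 k)

/-- `J` applied to a vector field. -/
def Jvf (X : VF n) : VF n := fun p => Jm fc p (X p)

/-- the curvature coefficients `R^k_{ij} = δG_i^k/δx^j − δG_j^k/δx^i` of the
nonlinear connection. -/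
def Rc (i j k : Fin n) (p : Pt n) : ℝ :=
  Dv (ddx fc j) (fc.N i k) p - Dv (ddx fc i) (fc.N j k) p

/-- the Cartan tensor `g_{ijk} = ½ ∂g_{ij}/∂y^k`. -/
def Cartan (i j k : Fin n) (p : Pt n) : ℝ := (1/2) * pd (ey k) (fc.g i j) p

/-- the vertical adapted frame field `∂̄/∂̄y^a = E_a^i ∂/∂y^i`. -/
def vb (E : Fin (n-1) → Fin n → Pt n → ℝ) (a : Fin (n-1)) : VF n :=
  fun p => ((0 : Fin n → ℝ), fun i => E a i p)

/-- the horizontal adapted frame field `δ̄/δ̄x^a = J(∂̄/∂̄y^a)`. -/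
def hb (E : Fin (n-1) → Fin n → Pt n → ℝ) (a : Fin (n-1)) : VF n :=
  fun p => Jm fc p (vb E a p)

/-- `E` is the coefficient matrix of an adapted local frame
`∂̄/∂̄y^a = E_a^i ∂/∂y^i`, `a = 1, …, n−1`, of the distribution `V'TM` (the
`G`-orthogonal complement of the vertical Liouville field `L` inside the
vertical distribution `VTM`): the coefficients are smooth, pointwise linearly
independent, and each `∂̄/∂̄y^a` is `G`-orthogonal to `L`. -/
def IsAdaptedFrame (E : Fin (n-1) → Fin n → Pt n → ℝ) : Prop :=
  (∀ a i, ContDiffOn ℝ (⊤ : ℕ∞) (E a i) fc.U) ∧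
  (∀ p ∈ fc.U, LinearIndependent ℝ (fun a : Fin (n-1) => (fun i => E a i p))) ∧
  (∀ a, ∀ p ∈ fc.U, Gs fc p (vb E a p) (LV p) = 0)

/-- `g_{ab} = g_{ij} E_a^i E_b^j`, the components of the Sasaki metric in the
adapted frame. -/
def gb (E : Fin (n-1) → Fin n → Pt n → ℝ) (p : Pt n) (a b : Fin (n-1)) : ℝ :=
  ∑ i, ∑ j, fc.g i j p * E a i p * E b j p

/-- the matrix `(g_{ab})`. -/
def gbMat (E : Fin (n-1) → Fin n → Pt n → ℝ) (p : Pt n) :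
    Matrix (Fin (n-1)) (Fin (n-1)) ℝ :=
  Matrix.of fun a b => gb fc E p a b

/-- `(g^{ab})`, the inverse of the matrix `(g_{ab})`. -/
def gbInv (E : Fin (n-1) → Fin n → Pt n → ℝ) (p : Pt n) (a b : Fin (n-1)) : ℝ :=
  (gbMat fc E p)⁻¹ a b

/-- `g_{abc} = ½ E_a^i E_b^j E_c^k g_{ijk}`, the Cartan tensor in the adapted
frame. -/
def CartanBar (E : Fin (n-1) → Fin n → Pt n → ℝ) (a b c : Fin (n-1))
    (p : Pt n) : ℝ :=
  (1/2) * ∑ i, ∑ j, ∑ k, E a i p * E b j p * E c k p * Cartan fc i j k p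

/-- `R_{cab} = E_c^i E_a^j E_b^k R^h_{jk} g_{hi}`, the lowered curvature of the
nonlinear connection in the adapted frame. -/
def Rlow (E : Fin (n-1) → Fin n → Pt n → ℝ) (c a b : Fin (n-1)) (p : Pt n) : ℝ :=
  ∑ i, ∑ j, ∑ k, ∑ h, E c i p * E a j p * E b k p * Rc fc j k h p * fc.g h i p

/-- `nab` is the Levi-Civita connection of the Sasaki metric `G` on the chart
domain, characterized by the Koszul formula
`2G(∇_X Y, Z) = X G(Y,Z) + Y G(X,Z) − Z G(X,Y)
  − G([X,Z],Y) − G([Y,Z],X) + G([X,Y],Z)`. -/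
def IsLeviCivita (nab : VF n → VF n → VF n) : Prop :=
  ∀ X Y Z : VF n,
    ContDiffOn ℝ (⊤ : ℕ∞) X fc.U → ContDiffOn ℝ (⊤ : ℕ∞) Y fc.U →
    ContDiffOn ℝ (⊤ : ℕ∞) Z fc.U → ∀ p ∈ fc.U,
    2 * Gs fc p (nab X Y p) (Z p) =
      Dv X (fun q => Gs fc q (Y q) (Z q)) p
      + Dv Y (fun q => Gs fc q (X q) (Z q)) p
      - Dv Z (fun q => Gs fc q (X q) (Y q)) p
      - Gs fc p (lie X Z p) (Y p)
      - Gs fc p (lie Y Z p) (X p)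
      + Gs fc p (lie X Y p) (Z p)

/-- the `G`-orthogonal projection of a vector field onto the line spanned by
the vertical Liouville field `L` (the normal direction to the indicatrix). -/
def projL (X : VF n) : VF n :=
  fun p => (Gs fc p (X p) (LV p) / Gs fc p (LV p) (LV p)) • LV p

/-- the curvature tensor `R(X,Y)Z = ∇_X ∇_Y Z − ∇_Y ∇_X Z − ∇_{[X,Y]} Z` of a
connection. -/
def curv (nab : VF n → VF n → VF n) (X Y Z : VF n) : VF n :=
  fun p => nab X (nab Y Z) p - nab Y (nab X Z) p - nab (lie X Y) Z p

/-- membership in `V'TM`: vertical and `G`-orthogonal to `L`. -/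
def InV' (p v : Pt n) : Prop := v.1 = 0 ∧ Gs fc p v (LV p) = 0

/-- membership in `V^⊥TM`: `G`-orthogonal to `L`. -/
def InVperp (p v : Pt n) : Prop := Gs fc p v (LV p) = 0

/-- membership in `HTM ⊕ ⟨L⟩`, the `G`-orthogonal complement of `V'TM`. -/
def InHL (p v : Pt n) : Prop := ∃ c : ℝ, ∀ i, dely fc i p v = c * p.2 i

/-- membership in the line spanned by the vertical Liouville field `L`. -/
def InL (p v : Pt n) : Prop := ∃ c : ℝ, v = c • LV p

/-- membership in the plane spanned by `L` and `ξ`. -/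
def InLXi (p v : Pt n) : Prop := ∃ c d : ℝ, v = c • LV p + d • XI fc p

/-- membership in the `G`-orthogonal complement of `⟨L, ξ⟩`. -/
def InLXiPerp (p v : Pt n) : Prop :=
  Gs fc p v (LV p) = 0 ∧ Gs fc p v (XI fc p) = 0

/-- the contact `1`-form `η = y^i g_{ij} dx^j` of the indicatrix bundle,
applied to a tangent vector. -/
def etaC (p : Pt n) (v : Pt n) : ℝ := ∑ i, ∑ j, p.2 i * fc.g i j p * v.1 j

/-- the `(1,1)`-tensor `φ` of the contact structure of the indicatrix bundle:
`φ = J` on the contact distribution `D` and `φ(ξ) = 0`; on tangent vectors of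
`IM` it is given by `φ(v) = J v + η(v) L`. -/
def phiC (p : Pt n) (v : Pt n) : Pt n := Jm fc p v + etaC fc p v • LV p

/-- `φ` applied to a vector field. -/
def phiVF (X : VF n) : VF n := fun p => phiC fc p (X p)

/-- `η` applied to a vector field, as a scalar function. -/
def etaVF (X : VF n) : Pt n → ℝ := fun p => etaC fc p (X p)

/-- the exterior derivative `dη(X,Y) = X(η(Y)) − Y(η(X)) − η([X,Y])`. -/
def dEta (X Y : VF n) (p : Pt n) : ℝ :=
  Dv X (etaVF fc Y) p - Dv Y (etaVF fc X) p - etaC fc p (lie X Y p)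

/-- the normality tensor `N^{(1)} = [φ,φ] + 2 dη ⊗ ξ` of the contact structure
of the indicatrix bundle, evaluated on vector fields, where
`[φ,φ](X,Y) = φ²[X,Y] + [φX,φY] − φ[φX,Y] − φ[X,φY]` is the Nijenhuis torsion
of `φ`. -/
def Ntensor (X Y : VF n) : VF n := fun p =>
  phiC fc p (phiC fc p (lie X Y p)) + lie (phiVF fc X) (phiVF fc Y) p
    - phiC fc p (lie (phiVF fc X) Y p) - phiC fc p (lie X (phiVF fc Y) p)
    + (2 * dEta fc X Y p) • XI fc p

/-- a vector field of `TM` is tangent to the indicatrix bundle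
`IM = {F = 1}` (equivalently, `G`-orthogonal to the normal field `L` along
`IM`). -/
def TangentIM (X : VF n) : Prop :=
  ∀ p ∈ fc.U, fc.F p = 1 → Gs fc p (X p) (LV p) = 0

/-- The indicatrix bundle `IM`, with its natural contact metric structure
`(φ, η, ξ, Ḡ)`, is a Sasakian manifold: the contact structure is normal, i.e.
the tensor `N^{(1)} = [φ,φ] + 2 dη ⊗ ξ` vanishes on vector fields tangent to
`IM`. -/
def IsSasakianIM : Prop :=
  ∀ X Y : VF n, ContDiffOn ℝ (⊤ : ℕ∞) X fc.U → ContDiffOn ℝ (⊤ : ℕ∞) Y fc.U →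
    TangentIM fc X → TangentIM fc Y →
    ∀ p ∈ fc.U, fc.F p = 1 → Ntensor fc X Y p = 0

/-- the Nijenhuis tensor of the natural almost complex structure `J`:
`N_J(X,Y) = [JX,JY] − J[JX,Y] − J[X,JY] + J²[X,Y]`, with `J² = −Id`. -/
def NijJ (X Y : VF n) : VF n := fun p =>
  lie (Jvf fc X) (Jvf fc Y) p - Jm fc p (lie (Jvf fc X) Y p)
    - Jm fc p (lie X (Jvf fc Y) p) - lie X Y p

/-- the almost complex structure `J̄` on `TM ≅ IM × ℝ` induced by the contact
structure `(φ, η, ξ)` of the indicatrix bundle via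
`J̄(X + f L) = φ(X) − f ξ + η(X) L`, where `X` is tangent to `IM`;
a tangent vector `v` is decomposed as `v = vᵀ + f L` with
`f = G(v,L)/G(L,L)` and `vᵀ` tangent to the indicatrix. -/
def Jbar (p : Pt n) (v : Pt n) : Pt n :=
  phiC fc p (v - (Gs fc p v (LV p) / Gs fc p (LV p) (LV p)) • LV p)
    - (Gs fc p v (LV p) / Gs fc p (LV p) (LV p)) • XI fc p
    + etaC fc p (v - (Gs fc p v (LV p) / Gs fc p (LV p) (LV p)) • LV p) • LV p


section LeviCivita

open scoped ContDiff Topology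
open VectorField

lemma contDiffOn_of_clm_apply_eq {V W W' : Type*} [NormedAddCommGroup V] [NormedSpace ℝ V]
    [NormedAddCommGroup W] [NormedSpace ℝ W] [FiniteDimensional ℝ W]
    [NormedAddCommGroup W'] [NormedSpace ℝ W'] [FiniteDimensional ℝ W']
    {U : Set V} {A : V → W →L[ℝ] W'} {b : V → W'} {s : V → W}
    (hdim : Module.finrank ℝ W = Module.finrank ℝ W')
    (hA : ContDiffOn ℝ ∞ A U) (hinj : ∀ p ∈ U, Function.Injective (A p))
    (hb : ContDiffOn ℝ ∞ b U) (hs : ∀ p ∈ U, A p (s p) = b p) :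
    ContDiffOn ℝ ∞ s U := by
  have : CompleteSpace W := FiniteDimensional.complete ℝ W
  have key : ∀ p ∈ U, ∃ e : W ≃L[ℝ] W', (e : W →L[ℝ] W') = A p := fun p hp =>
    ⟨((A p : W →ₗ[ℝ] W').linearEquivOfInjective (hinj p hp) hdim).toContinuousLinearEquiv, by
      ext; rfl⟩
  have hinv : ContDiffOn ℝ ∞ (fun p => (A p).inverse) U := fun p hp => by
    obtain ⟨e, he⟩ := key p hp
    exact ContDiffAt.comp_contDiffWithinAt p (he ▸ contDiffAt_map_inverse e) (hA p hp)
  refine (hinv.clm_apply hb).congr fun p hp => ?_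
  obtain ⟨e, he⟩ := key p hp
  rw [← hs p hp, ← he, ContinuousLinearMap.inverse_equiv]
  simp

variable {V : Type*} [NormedAddCommGroup V] [NormedSpace ℝ V]

/-- A smooth field of symmetric nondegenerate bilinear forms on an open set. -/
structure IsMetricOn (U : Set V) (G : V → V →L[ℝ] V →L[ℝ] ℝ) : Prop where
  isOpen : IsOpen U
  smooth : ContDiffOn ℝ ∞ G U
  symm : ∀ p ∈ U, ∀ v w, G p v w = G p w v
  nondeg : ∀ p ∈ U, ∀ v, (∀ w, G p v w = 0) → v = 0

/-- The Koszul formula for `nab` with respect to the metric `G` on `U`. -/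
def IsKoszul (U : Set V) (G : V → V →L[ℝ] V →L[ℝ] ℝ)
    (nab : (V → V) → (V → V) → V → V) : Prop :=
  ∀ X Y Z : V → V, ContDiffOn ℝ ∞ X U → ContDiffOn ℝ ∞ Y U → ContDiffOn ℝ ∞ Z U → ∀ p ∈ U,
    2 * G p (nab X Y p) (Z p) =
      fderiv ℝ (fun q => G q (Y q) (Z q)) p (X p)
      + fderiv ℝ (fun q => G q (X q) (Z q)) p (Y p)
      - fderiv ℝ (fun q => G q (X q) (Y q)) p (Z p)
      - G p (lieBracket ℝ X Z p) (Y p)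
      - G p (lieBracket ℝ Y Z p) (X p)
      + G p (lieBracket ℝ X Y p) (Z p)

variable {U : Set V} {G : V → V →L[ℝ] V →L[ℝ] ℝ} {nab : (V → V) → (V → V) → V → V}
  {X Y Z : V → V} {p : V}

lemma differentiableAt_of_contDiffOn {W : Type*} [NormedAddCommGroup W] [NormedSpace ℝ W]
    {f : V → W} (hU : IsOpen U) (hf : ContDiffOn ℝ ∞ f U) (hp : p ∈ U) :
    DifferentiableAt ℝ f p :=
  (hf.contDiffAt (hU.mem_nhds hp)).differentiableAt (by simp)

lemma contDiffOn_fderiv_apply {W : Type*} [NormedAddCommGroup W] [NormedSpace ℝ W]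
    {f : V → W} (hU : IsOpen U) (hf : ContDiffOn ℝ ∞ f U) (hX : ContDiffOn ℝ ∞ X U) :
    ContDiffOn ℝ ∞ (fun q => fderiv ℝ f q (X q)) U :=
  (hf.fderiv_of_isOpen hU le_rfl).clm_apply hX

lemma fderiv_congr_of_eqOn {W : Type*} [NormedAddCommGroup W] [NormedSpace ℝ W]
    {f f' : V → W} (hU : IsOpen U) (h : ∀ q ∈ U, f q = f' q) (hp : p ∈ U) :
    fderiv ℝ f p = fderiv ℝ f' p :=
  Filter.EventuallyEq.fderiv_eq (Filter.eventually_of_mem (hU.mem_nhds hp) h)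

namespace IsMetricOn

variable (hG : IsMetricOn U G)
include hG

lemma smooth_apply (hX : ContDiffOn ℝ ∞ X U) (hY : ContDiffOn ℝ ∞ Y U) :
    ContDiffOn ℝ ∞ (fun q => G q (X q) (Y q)) U :=
  (hG.smooth.clm_apply hX).clm_apply hY

lemma eq_of_forall (hp : p ∈ U) {v w : V} (h : ∀ z, G p v z = G p w z) : v = w :=
  sub_eq_zero.1 <| hG.nondeg p hp _ fun z => by simp [h z]

lemma smooth_lieBracket (hX : ContDiffOn ℝ ∞ X U) (hY : ContDiffOn ℝ ∞ Y U) :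
    ContDiffOn ℝ ∞ (lieBracket ℝ X Y) U :=
  (contDiffOn_fderiv_apply hG.isOpen hY hX).sub (contDiffOn_fderiv_apply hG.isOpen hX hY)

lemma fderiv_apply (hX : ContDiffOn ℝ ∞ X U) (hY : ContDiffOn ℝ ∞ Y U) (hp : p ∈ U) (v : V) :
    fderiv ℝ (fun q => G q (X q) (Y q)) p v =
      fderiv ℝ G p v (X p) (Y p) + G p (fderiv ℝ X p v) (Y p) + G p (X p) (fderiv ℝ Y p v) := by
  have h1 := (differentiableAt_of_contDiffOn hG.isOpen hG.smooth hp).hasFDerivAt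
  have h2 := (differentiableAt_of_contDiffOn hG.isOpen hX hp).hasFDerivAt
  have h3 := (differentiableAt_of_contDiffOn hG.isOpen hY hp).hasFDerivAt
  rw [((h1.clm_apply h2).clm_apply h3).fderiv]
  simp
  ring

lemma fderiv_symm (hp : p ∈ U) (u v w : V) :
    fderiv ℝ G p u v w = fderiv ℝ G p u w v := by
  have h1 := hG.fderiv_apply (X := fun _ => v) (Y := fun _ => w) contDiffOn_const
    contDiffOn_const hp u
  have h2 := hG.fderiv_apply (X := fun _ => w) (Y := fun _ => v) contDiffOn_const
    contDiffOn_const hp u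
  have h3 := fderiv_congr_of_eqOn hG.isOpen (fun q hq => hG.symm q hq v w) hp
  simp only [fderiv_const_apply, zero_apply, map_zero, add_zero] at h1 h2
  rw [← h1, ← h2, h3]

variable (hK : IsKoszul U G nab)
include hK

lemma nab_apply (hX : ContDiffOn ℝ ∞ X U) (hY : ContDiffOn ℝ ∞ Y U) (hp : p ∈ U) (z : V) :
    2 * G p (nab X Y p) z = 2 * G p (fderiv ℝ Y p (X p)) z +
      fderiv ℝ G p (X p) (Y p) z + fderiv ℝ G p (Y p) (X p) z - fderiv ℝ G p z (X p) (Y p) := by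
  have h := hK X Y (fun _ => z) hX hY contDiffOn_const p hp
  rw [hG.fderiv_apply hX contDiffOn_const hp, hG.fderiv_apply hY contDiffOn_const hp,
    hG.fderiv_apply hX hY hp] at h
  simp only [lieBracket, fderiv_const_apply, zero_apply, map_zero, add_zero,
    zero_sub, map_neg, map_sub, neg_apply,
    sub_apply] at h
  rw [h, hG.symm p hp (X p)]
  ring

lemma nab_smooth [FiniteDimensional ℝ V] (hX : ContDiffOn ℝ ∞ X U) (hY : ContDiffOn ℝ ∞ Y U) :
    ContDiffOn ℝ ∞ (nab X Y) U := by
  have hdim : Module.finrank ℝ V = Module.finrank ℝ (V →L[ℝ] ℝ) := by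
    rw [← Subspace.dual_finrank_eq]
    exact LinearMap.toContinuousLinearMap.finrank_eq
  refine contDiffOn_of_clm_apply_eq (A := G) (b := fun p => G p (nab X Y p)) hdim hG.smooth
    (fun p hp => ?_) ?_ fun p _ => rfl
  · refine (injective_iff_map_eq_zero _).2 fun v hv => hG.nondeg p hp v fun w => ?_
    rw [hv]; rfl
  · refine contDiffOn_clm_apply.2 fun z => ?_
    have hz : ContDiffOn ℝ ∞ (fun _ : V => z) U := contDiffOn_const
    have hDG := fun {A : V → V} (hA : ContDiffOn ℝ ∞ A U) =>
      contDiffOn_fderiv_apply hG.isOpen hG.smooth hA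
    refine ContDiffOn.congr (f := fun p => G p (fderiv ℝ Y p (X p)) z + (1 / 2) * (
      fderiv ℝ G p (X p) (Y p) z + fderiv ℝ G p (Y p) (X p) z - fderiv ℝ G p z (X p) (Y p))) ?_
      fun p hp => ?_
    · exact (hG.smooth_apply (contDiffOn_fderiv_apply hG.isOpen hY hX) hz).add
        (contDiffOn_const.mul (((((hDG hX).clm_apply hY).clm_apply hz).add
          (((hDG hY).clm_apply hX).clm_apply hz)).sub
          (((hDG hz).clm_apply hX).clm_apply hY)))
    · linarith [hG.nab_apply hK hX hY hp z]

/-- Metric compatibility. -/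
lemma fderiv_metric (hX : ContDiffOn ℝ ∞ X U) (hY : ContDiffOn ℝ ∞ Y U)
    (hZ : ContDiffOn ℝ ∞ Z U) (hp : p ∈ U) :
    fderiv ℝ (fun q => G q (Y q) (Z q)) p (X p) =
      G p (nab X Y p) (Z p) + G p (Y p) (nab X Z p) := by
  have h1 := hG.nab_apply hK hX hY hp (Z p)
  have h2 := hG.nab_apply hK hX hZ hp (Y p)
  rw [hG.fderiv_apply hY hZ hp, hG.symm p hp (Y p), hG.symm p hp (Y p)]
  linarith [hG.fderiv_symm hp (X p) (Y p) (Z p), hG.fderiv_symm hp (Y p) (X p) (Z p),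
    hG.fderiv_symm hp (Z p) (X p) (Y p)]

lemma nab_sub_nab (hX : ContDiffOn ℝ ∞ X U) (hY : ContDiffOn ℝ ∞ Y U) (hp : p ∈ U) :
    nab X Y p - nab Y X p = lieBracket ℝ X Y p := by
  refine hG.eq_of_forall hp fun z => ?_
  have h1 := hG.nab_apply hK hX hY hp z
  have h2 := hG.nab_apply hK hY hX hp z
  have h3 := hG.fderiv_symm hp z (X p) (Y p)
  simp only [lieBracket, map_sub, sub_apply]
  linarith

lemma nab_congr {Y' : V → V} (hX : ContDiffOn ℝ ∞ X U) (hY : ContDiffOn ℝ ∞ Y U)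
    (hY' : ContDiffOn ℝ ∞ Y' U) (hp : p ∈ U) (h : Y p = Y' p)
    (hd : fderiv ℝ Y p (X p) = fderiv ℝ Y' p (X p)) : nab X Y p = nab X Y' p := by
  refine hG.eq_of_forall hp fun z => ?_
  have h1 := hG.nab_apply hK hX hY hp z
  have h2 := hG.nab_apply hK hX hY' hp z
  rw [h, hd] at h1
  linarith

lemma nab_congr_of_eqOn {Y' : V → V} (hX : ContDiffOn ℝ ∞ X U) (hY : ContDiffOn ℝ ∞ Y U)
    (h : ∀ q ∈ U, Y q = Y' q) (hp : p ∈ U) : nab X Y p = nab X Y' p :=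
  hG.nab_congr hK hX hY (hY.congr fun q hq => (h q hq).symm) hp (h p hp)
    (by rw [fderiv_congr_of_eqOn hG.isOpen h hp])

lemma nab_sub_smul {f : V → ℝ} {L : V → V} (hX : ContDiffOn ℝ ∞ X U) (hY : ContDiffOn ℝ ∞ Y U)
    (hf : ContDiffOn ℝ ∞ f U) (hL : ContDiffOn ℝ ∞ L U) (hp : p ∈ U) :
    nab X (fun q => Y q - f q • L q) p =
      nab X Y p - fderiv ℝ f p (X p) • L p - f p • nab X L p := by
  refine hG.eq_of_forall hp fun z => ?_
  have h1 := hG.nab_apply hK hX hY hp z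
  have h2 := hG.nab_apply hK hX hL hp z
  have h3 : 2 * G p (nab X (fun q => Y q - f q • L q) p) z = _ :=
    hG.nab_apply hK hX (hY.sub (hf.smul hL)) hp z
  have hd : fderiv ℝ (fun q => Y q - f q • L q) p = _ :=
    ((differentiableAt_of_contDiffOn hG.isOpen hY hp).hasFDerivAt.sub
    ((differentiableAt_of_contDiffOn hG.isOpen hf hp).hasFDerivAt.smul
      (differentiableAt_of_contDiffOn hG.isOpen hL hp).hasFDerivAt)).fderiv
  change _ = 2 * G p (fderiv ℝ (fun q => Y q - f q • L q) p (X p)) z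
    + fderiv ℝ G p (X p) (Y p - f p • L p) z + fderiv ℝ G p (Y p - f p • L p) (X p) z
    - fderiv ℝ G p z (X p) (Y p - f p • L p) at h3
  rw [hd] at h3
  simp only [map_sub, map_smul, map_add, sub_apply,
    add_apply, smul_apply, smul_eq_mul,
    ContinuousLinearMap.smulRight_apply] at h3 ⊢
  linear_combination (1 / 2) * h3 - (1 / 2) * h1 + (f p / 2) * h2

lemma nab_zero {Y : V → V} (hX : ContDiffOn ℝ ∞ X U) (hY : ∀ q ∈ U, Y q = 0) (hp : p ∈ U) :
    nab X Y p = 0 := by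
  have hY' : ContDiffOn ℝ ∞ Y U := contDiffOn_const.congr hY
  refine hG.eq_of_forall hp fun z => ?_
  have h1 := hG.nab_apply hK hX hY' hp z
  rw [fderiv_congr_of_eqOn (f' := fun _ => 0) hG.isOpen hY hp, hY p hp] at h1
  simpa using h1

/-- If `Z` and `L` are orthogonal on `U`, then so are `∇_X Z` and `L` up to `G(Z, ∇_X L)`. -/
lemma nab_orthogonal {L : V → V} (hX : ContDiffOn ℝ ∞ X U) (hZ : ContDiffOn ℝ ∞ Z U)
    (hL : ContDiffOn ℝ ∞ L U) (h : ∀ q ∈ U, G q (Z q) (L q) = 0) (hp : p ∈ U) :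
    G p (nab X Z p) (L p) = - G p (Z p) (nab X L p) := by
  have h1 := hG.fderiv_metric hK hX hZ hL hp
  rw [fderiv_congr_of_eqOn (f' := fun _ => 0) hG.isOpen h hp] at h1
  simp only [fderiv_const_apply, zero_apply] at h1
  linarith

/-- `G(R(X,Y)Z, L) = -G(Z, R(X,Y)L)` when `Z` and `L` are orthogonal. -/
lemma curvature_skew [FiniteDimensional ℝ V] {L : V → V} (hX : ContDiffOn ℝ ∞ X U)
    (hY : ContDiffOn ℝ ∞ Y U) (hZ : ContDiffOn ℝ ∞ Z U) (hL : ContDiffOn ℝ ∞ L U)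
    (h : ∀ q ∈ U, G q (Z q) (L q) = 0) (hp : p ∈ U) :
    G p (nab X (nab Y Z) p - nab Y (nab X Z) p - nab (lieBracket ℝ X Y) Z p) (L p) =
      - G p (Z p) (nab X (nab Y L) p - nab Y (nab X L) p - nab (lieBracket ℝ X Y) L p) := by
  have aux : ∀ {A B : V → V}, ContDiffOn ℝ ∞ A U → ContDiffOn ℝ ∞ B U →
      G p (nab A (nab B Z) p) (L p) = - G p (nab A Z p) (nab B L p)
        - G p (Z p) (nab A (nab B L) p) - G p (nab B Z p) (nab A L p) := by
    intro A B hA hB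
    have h1 := hG.fderiv_metric hK hA (hG.nab_smooth hK hB hZ) hL hp
    have h2 := hG.fderiv_metric hK hA hZ (hG.nab_smooth hK hB hL) hp
    rw [fderiv_congr_of_eqOn (f' := fun q => - G q (Z q) (nab B L q)) hG.isOpen
      (fun q hq => hG.nab_orthogonal hK hB hZ hL h hq) hp, fderiv_fun_neg,
      neg_apply, h2] at h1
    linarith
  have h3 := hG.nab_orthogonal hK (hG.smooth_lieBracket hX hY) hZ hL h hp
  have h1 := aux hX hY
  have h2 := aux hY hX
  simp only [map_sub, sub_apply]
  linarith

/-- The Gauss–Codazzi equation for a level set `S` with unit normal `L` and induced connection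
`nabBar`, given by tangential projection along `S`. -/
theorem gauss_equation [FiniteDimensional ℝ V] {nabBar : (V → V) → (V → V) → V → V}
    {S : Set V} {L : V → V} (hL : ContDiffOn ℝ ∞ L U)
    (hLpos : ∀ q ∈ U, 0 < G q (L q) (L q))
    (hLS : ∀ q ∈ U, q ∈ S → G q (L q) (L q) = 1)
    (hLdiff : ∀ q ∈ U, ∀ v, G q v (L q) = 0 → fderiv ℝ (fun r => G r (L r) (L r)) q v = 0)
    (hS : ∀ W : V → V, ContDiffOn ℝ ∞ W U → (∀ q ∈ U, q ∈ S → W q = 0) →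
      ∀ q ∈ U, q ∈ S → ∀ v, G q v (L q) = 0 → fderiv ℝ W q v = 0)
    (hGauss : ∀ X Y : V → V, ∀ q ∈ U, q ∈ S → nabBar X Y q =
      nab X Y q - (G q (nab X Y q) (L q) / G q (L q) (L q)) • L q)
    (hBar : ∀ X Y : V → V, ContDiffOn ℝ ∞ X U → ContDiffOn ℝ ∞ Y U →
      ContDiffOn ℝ ∞ (nabBar X Y) U)
    (hX : ContDiffOn ℝ ∞ X U) (hY : ContDiffOn ℝ ∞ Y U) (hZ : ContDiffOn ℝ ∞ Z U)
    (hXL : ∀ q ∈ U, G q (X q) (L q) = 0) (hYL : ∀ q ∈ U, G q (Y q) (L q) = 0)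
    (hZL : ∀ q ∈ U, G q (Z q) (L q) = 0) (hp : p ∈ U) (hpS : p ∈ S) :
    nab X (nab Y Z) p - nab Y (nab X Z) p - nab (lieBracket ℝ X Y) Z p =
      nabBar X (nabBar Y Z) p - nabBar Y (nabBar X Z) p - nabBar (lieBracket ℝ X Y) Z p
      - G p (Z p) (nab Y L p) • nab X L p + G p (Z p) (nab X L p) • nab Y L p
      - G p (Z p) (nab X (nab Y L) p - nab Y (nab X L) p - nab (lieBracket ℝ X Y) L p) • L p := by
  have aux : ∀ {A B : V → V}, ContDiffOn ℝ ∞ A U → ContDiffOn ℝ ∞ B U →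
      (∀ q ∈ U, G q (A q) (L q) = 0) →
      nabBar A (nabBar B Z) p = nab A (nab B Z) p - G p (nab A (nab B Z) p) (L p) • L p
        + G p (Z p) (nab B L p) • nab A L p := by
    intro A B hA hB hAL
    set f : V → ℝ := fun q => G q (nab B Z q) (L q) / G q (L q) (L q) with hf
    have hBZ := hG.nab_smooth hK hB hZ
    have hfs : ContDiffOn ℝ ∞ f U := (hG.smooth_apply hBZ hL).div (hG.smooth_apply hL hL)
      fun q hq => (hLpos q hq).ne'
    have hT : ContDiffOn ℝ ∞ (fun q => nab B Z q - f q • L q) U := hBZ.sub (hfs.smul hL)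
    have hW := hBar B Z hB hZ
    have hWp := hGauss B Z p hp hpS
    have hd : fderiv ℝ (nabBar B Z) p (A p)
        = fderiv ℝ (fun q => nab B Z q - f q • L q) p (A p) := by
      have := hS _ (hW.sub hT) (fun q hq hqS => by
        simp only [hGauss B Z q hq hqS, hf, sub_self]) p hp hpS (A p) (hAL p hp)
      rw [fderiv_fun_sub (differentiableAt_of_contDiffOn hG.isOpen hW hp)
        (differentiableAt_of_contDiffOn hG.isOpen hT hp), sub_apply] at this
      exact sub_eq_zero.1 this
    have hfp : f p = - G p (Z p) (nab B L p) := by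
      rw [hf]
      simp only [hLS p hp hpS, div_one]
      exact hG.nab_orthogonal hK hB hZ hL hZL hp
    have hLL : G p (nab A L p) (L p) = 0 := by
      have := hG.fderiv_metric hK hA hL hL hp
      rw [hLdiff p hp _ (hAL p hp), hG.symm p hp (L p)] at this
      linarith
    rw [hGauss A _ p hp hpS, hG.nab_congr hK hA hW hT hp hWp hd,
      hG.nab_sub_smul hK hA hBZ hfs hL hp, hfp, hLS p hp hpS]
    simp only [map_sub, map_smul, sub_apply, smul_apply,
      hLS p hp hpS, hLL, smul_eq_mul, div_one]
    module
  have hsk := hG.curvature_skew hK hX hY hZ hL hZL hp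
  rw [← neg_eq_iff_eq_neg] at hsk
  rw [aux hX hY hXL, aux hY hX hYL, hGauss _ _ p hp hpS, hLS p hp hpS, ← hsk]
  simp only [map_sub, sub_apply]
  module

end IsMetricOn

end LeviCivita

section FinslerCalculus

open scoped ContDiff Topology

lemma pd_smooth {U : Set (Pt n)} (hU : IsOpen U) {f : Pt n → ℝ} (hf : ContDiffOn ℝ ∞ f U)
    (v : Pt n) : ContDiffOn ℝ ∞ (pd v f) U :=
  contDiffOn_fderiv_apply (X := fun _ => v) hU hf contDiffOn_const

lemma fderiv_pd {U : Set (Pt n)} (hU : IsOpen U) {f : Pt n → ℝ} (hf : ContDiffOn ℝ ∞ f U)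
    {p : Pt n} (hp : p ∈ U) (v w : Pt n) :
    fderiv ℝ (pd v f) p w = fderiv ℝ (fderiv ℝ f) p w v := by
  have h := differentiableAt_of_contDiffOn hU (hf.fderiv_of_isOpen hU (m := ∞) le_rfl) hp
  change fderiv ℝ (fun q => fderiv ℝ f q v) p w = _
  rw [fderiv_clm_apply h (differentiableAt_const v)]
  simp

lemma fderiv_fderiv_comm {U : Set (Pt n)} (hU : IsOpen U) {f : Pt n → ℝ}
    (hf : ContDiffOn ℝ ∞ f U) {p : Pt n} (hp : p ∈ U) (v w : Pt n) :
    fderiv ℝ (fderiv ℝ f) p w v = fderiv ℝ (fderiv ℝ f) p v w :=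
  (hf.contDiffAt (hU.mem_nhds hp)).isSymmSndFDerivAt
    (by
      rw [minSmoothness_of_isRCLikeNormedField]
      exact WithTop.coe_le_coe.2 (le_top : (2 : ℕ∞) ≤ ⊤)) w v

lemma pd_comm {U : Set (Pt n)} (hU : IsOpen U) {f : Pt n → ℝ} (hf : ContDiffOn ℝ ∞ f U)
    {p : Pt n} (hp : p ∈ U) (v w : Pt n) : pd v (pd w f) p = pd w (pd v f) p := by
  rw [pd, pd, fderiv_pd hU hf hp, fderiv_pd hU hf hp, fderiv_fderiv_comm hU hf hp]

lemma pd_congr {U : Set (Pt n)} (hU : IsOpen U) {f f' : Pt n → ℝ} (h : ∀ q ∈ U, f q = f' q)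
    {p : Pt n} (hp : p ∈ U) (v : Pt n) : pd v f p = pd v f' p := by
  rw [pd, pd, fderiv_congr_of_eqOn hU h hp]

lemma fderiv_eq_sum_pd (f : Pt n → ℝ) (p v : Pt n) :
    fderiv ℝ f p v = ∑ k, v.1 k * pd (ex k) f p + ∑ k, v.2 k * pd (ey k) f p := by
  have h : v = ∑ k, v.1 k • ex k + ∑ k, v.2 k • ey k := by
    ext i <;> simp [ex, ey, Prod.fst_sum, Prod.snd_sum, Finset.sum_apply, Pi.single_apply]
  conv_lhs => rw [h]
  simp [pd]

lemma fderiv_sum_mul {ι : Type*} [Fintype ι] {a b : ι → Pt n → ℝ} {p : Pt n}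
    (ha : ∀ i, DifferentiableAt ℝ (a i) p) (hb : ∀ i, DifferentiableAt ℝ (b i) p) (v : Pt n) :
    fderiv ℝ (fun q => ∑ i, a i q * b i q) p v =
      ∑ i, (fderiv ℝ (a i) p v * b i p + a i p * fderiv ℝ (b i) p v) := by
  have h : HasFDerivAt (fun q => ∑ i, a i q * b i q) _ p :=
    HasFDerivAt.fun_sum fun i _ => (ha i).hasFDerivAt.mul (hb i).hasFDerivAt
  rw [h.fderiv]
  simp only [sum_apply, add_apply, smul_apply, smul_eq_mul]
  exact Finset.sum_congr rfl fun i _ => by ring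

lemma fderiv_snd_apply (p v : Pt n) (k : Fin n) :
    fderiv ℝ (fun q : Pt n => q.2 k) p v = v.2 k := by
  have h : HasFDerivAt (fun q : Pt n => q.2 k)
      ((ContinuousLinearMap.proj (R := ℝ) (φ := fun _ : Fin n => ℝ) k).comp
        (ContinuousLinearMap.snd ℝ (Fin n → ℝ) (Fin n → ℝ))) p :=
    ((ContinuousLinearMap.proj (R := ℝ) (φ := fun _ : Fin n => ℝ) k).comp
      (ContinuousLinearMap.snd ℝ (Fin n → ℝ) (Fin n → ℝ))).hasFDerivAt
  rw [h.fderiv]; rfl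

lemma fderiv_LV (p v : Pt n) :
    fderiv ℝ (LV (n := n)) p v = (0, v.2) := by
  have h : HasFDerivAt (LV (n := n))
      ((ContinuousLinearMap.inr ℝ (Fin n → ℝ) (Fin n → ℝ)).comp
        (ContinuousLinearMap.snd ℝ (Fin n → ℝ) (Fin n → ℝ))) p :=
    ((ContinuousLinearMap.inr ℝ (Fin n → ℝ) (Fin n → ℝ)).comp
      (ContinuousLinearMap.snd ℝ (Fin n → ℝ) (Fin n → ℝ))).hasFDerivAt
  rw [h.fderiv]; rfl

lemma smooth_snd_apply {U : Set (Pt n)} (k : Fin n) :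
    ContDiffOn ℝ ∞ (fun q : Pt n => q.2 k) U :=
  ((contDiff_apply ℝ ℝ k).comp contDiff_snd).contDiffOn

lemma LV_snd (p : Pt n) : (LV p).2 = p.2 := rfl

lemma smooth_LV {U : Set (Pt n)} : ContDiffOn ℝ ∞ (LV (n := n)) U :=
  (contDiff_const.prodMk contDiff_snd).contDiffOn

/-- Infinitesimal positive homogeneity of degree `k` in the fibre coordinates. -/
def IsHomogOn (U : Set (Pt n)) (k : ℝ) (f : Pt n → ℝ) : Prop :=
  ∀ p ∈ U, fderiv ℝ f p (LV p) = k * f p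

lemma IsHomogOn.fderiv_pd {U : Set (Pt n)} (hU : IsOpen U) {f : Pt n → ℝ}
    (hf : ContDiffOn ℝ ∞ f U) {k : ℝ} (h : IsHomogOn U k f) {p : Pt n} (hp : p ∈ U) (v : Pt n) :
    fderiv ℝ (pd v f) p (LV p) = k * pd v f p - pd (0, v.2) f p := by
  have h1 := congrArg (fun l => l v) (fderiv_congr_of_eqOn hU h hp)
  have hd := differentiableAt_of_contDiffOn hU (hf.fderiv_of_isOpen hU (m := ∞) le_rfl) hp
  rw [fderiv_clm_apply hd (differentiableAt_of_contDiffOn hU smooth_LV hp),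
    fderiv_const_mul (differentiableAt_of_contDiffOn hU hf hp)] at h1
  simp only [add_apply, ContinuousLinearMap.comp_apply, ContinuousLinearMap.flip_apply,
    smul_apply, smul_eq_mul, fderiv_LV] at h1
  rw [FinslerFoliations.fderiv_pd hU hf hp, fderiv_fderiv_comm hU hf hp, pd, pd]
  linarith

lemma IsHomogOn.pd_ey {U : Set (Pt n)} (hU : IsOpen U) {f : Pt n → ℝ}
    (hf : ContDiffOn ℝ ∞ f U) {k : ℝ} (h : IsHomogOn U k f) (j : Fin n) :
    IsHomogOn U (k - 1) (pd (ey j) f) := fun p hp => by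
  rw [h.fderiv_pd hU hf hp]
  simp only [ey]
  ring

lemma IsHomogOn.pd_ex {U : Set (Pt n)} (hU : IsOpen U) {f : Pt n → ℝ}
    (hf : ContDiffOn ℝ ∞ f U) {k : ℝ} (h : IsHomogOn U k f) (j : Fin n) :
    IsHomogOn U k (pd (ex j) f) := fun p hp => by
  rw [h.fderiv_pd hU hf hp]
  simp [ex, pd, ← Prod.zero_eq_mk]

lemma IsHomogOn.congr {U : Set (Pt n)} (hU : IsOpen U) {f f' : Pt n → ℝ} {k : ℝ}
    (h : IsHomogOn U k f) (hf : ∀ q ∈ U, f' q = f q) : IsHomogOn U k f' := fun p hp => by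
  rw [fderiv_congr_of_eqOn hU hf hp, h p hp, hf p hp]

lemma IsHomogOn.euler {U : Set (Pt n)} {f : Pt n → ℝ} {k : ℝ} (h : IsHomogOn U k f)
    {p : Pt n} (hp : p ∈ U) : ∑ j, p.2 j * pd (ey j) f p = k * f p := by
  rw [← h p hp, fderiv_eq_sum_pd]
  simp [LV]

namespace Chart

/-- The energy `F²`. -/
def energy : Pt n → ℝ := fun q => fc.F q ^ 2

lemma energy_smooth : ContDiffOn ℝ ∞ fc.energy fc.U := fc.Fsmooth.pow 2

lemma F_differentiableAt {p : Pt n} (hp : p ∈ fc.U) : DifferentiableAt ℝ fc.F p :=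
  differentiableAt_of_contDiffOn fc.hUopen fc.Fsmooth hp

lemma fderiv_energy {p : Pt n} (hp : p ∈ fc.U) (v : Pt n) :
    fderiv ℝ fc.energy p v = 2 * fc.F p * fderiv ℝ fc.F p v := by
  change fderiv ℝ (fun q => fc.F q ^ 2) p v = _
  rw [((fc.F_differentiableAt hp).hasFDerivAt.pow 2).fderiv]
  simp

lemma F_homog : IsHomogOn fc.U 1 fc.F := fun p hp => by
  have hc : HasDerivAt (fun t : ℝ => ((p.1, t • p.2) : Pt n)) (LV p) 1 := by
    have h : HasDerivAt (fun t : ℝ => ((p.1, t • p.2) : Pt n)) (0, p.2) 1 := by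
      simpa using (hasDerivAt_const (1 : ℝ) p.1).prodMk ((hasDerivAt_id (1 : ℝ)).smul_const p.2)
    exact h
  have hp1 : ((p.1, (1 : ℝ) • p.2) : Pt n) = p := by simp
  have h1 : HasDerivAt (fun t : ℝ => fc.F (p.1, t • p.2)) (fderiv ℝ fc.F p (LV p)) 1 := by
    have hF : HasFDerivAt fc.F (fderiv ℝ fc.F p) (p.1, (1 : ℝ) • p.2) := by
      rw [hp1]; exact (fc.F_differentiableAt hp).hasFDerivAt
    exact hF.comp_hasDerivAt (1 : ℝ) hc
  have h2 : HasDerivAt (fun t : ℝ => t * fc.F p) (1 * fc.F p) 1 :=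
    (hasDerivAt_id (1 : ℝ)).mul_const _
  have hU : ∀ᶠ t : ℝ in 𝓝 1, ((p.1, t • p.2) : Pt n) ∈ fc.U :=
    hc.continuousAt.eventually_mem (by rw [hp1]; exact fc.hUopen.mem_nhds hp)
  refine h1.unique (h2.congr_of_eventuallyEq ?_)
  filter_upwards [hU, lt_mem_nhds (zero_lt_one (α := ℝ))] with t ht ht0
  exact fc.Fhomog p hp t ht0 ht

lemma energy_homog : IsHomogOn fc.U 2 fc.energy := fun p hp => by
  rw [fc.fderiv_energy hp, fc.F_homog p hp, energy]
  ring

/-- The derivative of a function vanishing on the indicatrix vanishes in tangent directions. -/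
lemma fderiv_eq_zero_of_indicatrix {W : Pt n → Pt n} (hW : ContDiffOn ℝ ∞ W fc.U)
    (h0 : ∀ q ∈ fc.U, fc.F q = 1 → W q = 0) {p : Pt n} (hp : p ∈ fc.U) (hF : fc.F p = 1)
    {v : Pt n} (hv : fderiv ℝ fc.F p v = 0) : fderiv ℝ W p v = 0 := by
  have hinv : HasFDerivAt (fun q => (fc.F q)⁻¹) (-(fderiv ℝ fc.F p)) p := by
    have := (hasDerivAt_inv (by rw [hF]; exact one_ne_zero)).comp_hasFDerivAt p
      (fc.F_differentiableAt hp).hasFDerivAt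
    simpa [hF, Function.comp_def] using this
  have hP := (hasFDerivAt_fst (𝕜 := ℝ) (p := p)).prodMk
    (hinv.smul (hasFDerivAt_snd (𝕜 := ℝ) (p := p)))
  set P : Pt n → Pt n := fun q => (q.1, (fc.F q)⁻¹ • q.2) with hPdef
  have hPp : P p = p := by simp [hPdef, hF]
  have hWp : HasFDerivAt W (fderiv ℝ W p) (P p) := by
    rw [hPp]
    exact (differentiableAt_of_contDiffOn fc.hUopen hW hp).hasFDerivAt
  have hcomp := hWp.comp p hP
  have hPU : ∀ᶠ q in 𝓝 p, P q ∈ fc.U :=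
    hP.continuousAt.eventually_mem (by
      change fc.U ∈ 𝓝 (P p); rw [hPp]; exact fc.hUopen.mem_nhds hp)
  have hz : W ∘ P =ᶠ[𝓝 p] fun _ => 0 := by
    filter_upwards [hPU, fc.hUopen.mem_nhds hp] with q hq hqU
    have hpos := fc.Fpos q hqU
    refine h0 _ hq ?_
    rw [hPdef, fc.Fhomog q hqU _ (inv_pos.2 hpos) hq, inv_mul_cancel₀ hpos.ne']
  have := congrArg (fun l => l v) (hcomp.unique
    ((hasFDerivAt_const (0 : Pt n) p).congr_of_eventuallyEq hz))
  simpa [hv, hF] using this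

lemma g_eq {p : Pt n} (hp : p ∈ fc.U) (i j : Fin n) :
    fc.g i j p = (1 / 2) * pd (ey i) (pd (ey j) fc.energy) p := fc.gdef i j p hp

lemma pd_g {p : Pt n} (hp : p ∈ fc.U) (v : Pt n) (i j : Fin n) :
    pd v (fc.g i j) p = (1 / 2) * pd v (pd (ey i) (pd (ey j) fc.energy)) p := by
  have hs := pd_smooth fc.hUopen (pd_smooth fc.hUopen fc.energy_smooth (ey j)) (ey i)
  rw [pd_congr fc.hUopen (fc.gdef i j) hp]
  change fderiv ℝ (fun q => (1 / 2) * pd (ey i) (pd (ey j) fc.energy) q) p v = _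
  rw [fderiv_const_mul (differentiableAt_of_contDiffOn fc.hUopen hs hp)]
  rfl

lemma g_homog (i j : Fin n) : IsHomogOn fc.U 0 (fc.g i j) := fun p hp => by
  have h := ((fc.energy_homog.pd_ey fc.hUopen fc.energy_smooth j).pd_ey fc.hUopen
    (pd_smooth fc.hUopen fc.energy_smooth (ey j)) i) p hp
  have := fc.pd_g hp (LV p) i j
  rw [pd, pd, h] at this
  rw [this]
  ring

lemma g_contract {p : Pt n} (hp : p ∈ fc.U) (j : Fin n) :
    ∑ i, p.2 i * fc.g i j p = (1 / 2) * pd (ey j) fc.energy p := by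
  have h := (fc.energy_homog.pd_ey fc.hUopen fc.energy_smooth j).euler hp
  rw [show (2 - 1 : ℝ) * pd (ey j) fc.energy p = pd (ey j) fc.energy p by ring] at h
  rw [← h, Finset.mul_sum]
  refine Finset.sum_congr rfl fun i _ => ?_
  rw [fc.g_eq hp]
  ring

lemma g_nondeg {p : Pt n} (hp : p ∈ fc.U) {v : Fin n → ℝ}
    (h : ∀ i, ∑ j, fc.g i j p * v j = 0) : v = 0 := by
  by_contra hv
  refine (fc.gposdef p hp v hv).ne' ?_
  refine Finset.sum_eq_zero fun i _ => ?_
  rw [← mul_zero (v i), ← h i, Finset.mul_sum]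
  exact Finset.sum_congr rfl fun j _ => by ring

lemma spray_eq {p : Pt n} (hp : p ∈ fc.U) (j : Fin n) :
    4 * ∑ i, fc.g j i p * fc.spray i p =
      ∑ k, p.2 k * pd (ey j) (pd (ex k) fc.energy) p - pd (ex j) fc.energy p := by
  set b : Fin n → ℝ := fun l =>
    (∑ k, pd (ey l) (pd (ex k) (fun q => fc.F q ^ 2)) p * p.2 k)
        - pd (ex l) (fun q => fc.F q ^ 2) p with hb
  have hbj : b j = ∑ k, p.2 k * pd (ey j) (pd (ex k) fc.energy) p - pd (ex j) fc.energy p := by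
    change ∑ k, pd (ey j) (pd (ex k) fc.energy) p * p.2 k - pd (ex j) fc.energy p = _
    simp only [mul_comm]
  rw [← hbj]
  calc 4 * ∑ i, fc.g j i p * fc.spray i p
      = ∑ i, ∑ l, fc.g j i p * fc.ginv i l p * b l := by
        rw [Finset.mul_sum]
        refine Finset.sum_congr rfl fun i _ => ?_
        rw [fc.spraydef i p hp, Finset.mul_sum, Finset.mul_sum, Finset.mul_sum]
        exact Finset.sum_congr rfl fun l _ => by simp only [hb]; ring
    _ = ∑ l, (∑ i, fc.g j i p * fc.ginv i l p) * b l := by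
        rw [Finset.sum_comm]
        exact Finset.sum_congr rfl fun l _ => by rw [Finset.sum_mul]
    _ = b j := by simp [fc.hginv _ _ p hp]

lemma spray_smooth (i : Fin n) : ContDiffOn ℝ ∞ (fc.spray i) fc.U := by
  let A : Pt n → (Fin n → ℝ) →L[ℝ] (Fin n → ℝ) := fun p =>
    ContinuousLinearMap.pi fun i => ∑ j, fc.g i j p • ContinuousLinearMap.proj j
  have hA : ∀ p v i, A p v i = ∑ j, fc.g i j p * v j := fun p v i => by simp [A]
  have key : ContDiffOn ℝ ∞ (fun p i => fc.spray i p) fc.U := by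
    refine contDiffOn_of_clm_apply_eq (A := A) (b := fun p j => (1 / 4) *
      (∑ k, p.2 k * pd (ey j) (pd (ex k) fc.energy) p - pd (ex j) fc.energy p)) rfl ?_ ?_ ?_ ?_
    · refine contDiffOn_clm_apply.2 fun v => contDiffOn_pi.2 fun i => ?_
      simp only [hA]
      exact ContDiffOn.sum fun j _ => (fc.gsmooth i j).mul contDiffOn_const
    · refine fun p hp => (injective_iff_map_eq_zero _).2 fun v hv => fc.g_nondeg hp fun i => ?_
      rw [← hA, hv]; rfl
    · refine contDiffOn_pi.2 fun j => contDiffOn_const.mul ?_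
      exact (ContDiffOn.sum fun k _ => (smooth_snd_apply k).mul
        (pd_smooth fc.hUopen (pd_smooth fc.hUopen fc.energy_smooth _) _)).sub
          (pd_smooth fc.hUopen fc.energy_smooth _)
    · intro p hp
      funext j
      rw [hA, ← fc.spray_eq hp j]
      ring
  exact contDiffOn_pi.1 key i

lemma g_differentiableAt {p : Pt n} (hp : p ∈ fc.U) (i j : Fin n) :
    DifferentiableAt ℝ (fc.g i j) p :=
  differentiableAt_of_contDiffOn fc.hUopen (fc.gsmooth i j) hp

lemma N_differentiableAt {p : Pt n} (hp : p ∈ fc.U) (i j : Fin n) :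
    DifferentiableAt ℝ (fc.N i j) p :=
  differentiableAt_of_contDiffOn fc.hUopen (fc.Nsmooth i j) hp

lemma spray_differentiableAt {p : Pt n} (hp : p ∈ fc.U) (i : Fin n) :
    DifferentiableAt ℝ (fc.spray i) p :=
  differentiableAt_of_contDiffOn fc.hUopen (fc.spray_smooth i) hp

/-- The derivative of the spray equation. -/
lemma fderiv_spray_eq {p : Pt n} (hp : p ∈ fc.U) (j : Fin n) (v : Pt n) :
    4 * ∑ i, (fderiv ℝ (fc.g j i) p v * fc.spray i p + fc.g j i p * fderiv ℝ (fc.spray i) p v) =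
      ∑ k, (v.2 k * pd (ey j) (pd (ex k) fc.energy) p
        + p.2 k * fderiv ℝ (pd (ey j) (pd (ex k) fc.energy)) p v)
      - fderiv ℝ (pd (ex j) fc.energy) p v := by
  have hs1 : ∀ k, DifferentiableAt ℝ (pd (ey j) (pd (ex k) fc.energy)) p := fun k =>
    differentiableAt_of_contDiffOn fc.hUopen
      (pd_smooth fc.hUopen (pd_smooth fc.hUopen fc.energy_smooth _) _) hp
  have hs2 : DifferentiableAt ℝ (pd (ex j) fc.energy) p :=
    differentiableAt_of_contDiffOn fc.hUopen (pd_smooth fc.hUopen fc.energy_smooth _) hp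
  have hs3 : ∀ k, DifferentiableAt ℝ (fun q : Pt n => q.2 k) p := fun k =>
    differentiableAt_of_contDiffOn fc.hUopen (smooth_snd_apply k) hp
  have h := congrArg (fun l => l v)
    (fderiv_congr_of_eqOn fc.hUopen (fun q hq => fc.spray_eq hq j) hp)
  have hd1 : DifferentiableAt ℝ (fun q => ∑ i, fc.g j i q * fc.spray i q) p :=
    DifferentiableAt.fun_sum fun i _ =>
      (fc.g_differentiableAt hp j i).mul (fc.spray_differentiableAt hp i)
  have hd2 : DifferentiableAt ℝ (fun q : Pt n =>
      ∑ k, q.2 k * pd (ey j) (pd (ex k) fc.energy) q) p :=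
    DifferentiableAt.fun_sum fun k _ => (hs3 k).mul (hs1 k)
  rw [fderiv_const_mul hd1, fderiv_fun_sub hd2 hs2, smul_apply, sub_apply,
    fderiv_sum_mul (fun i => fc.g_differentiableAt hp j i)
      (fun i => fc.spray_differentiableAt hp i), fderiv_sum_mul hs3 hs1] at h
  simpa only [fderiv_snd_apply, smul_eq_mul] using h

lemma spray_homog (i : Fin n) : IsHomogOn fc.U 2 (fc.spray i) := fun p hp => by
  suffices h : (fun i => fderiv ℝ (fc.spray i) p (LV p) - 2 * fc.spray i p) = 0 from
    sub_eq_zero.1 (congrFun h i)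
  refine fc.g_nondeg hp fun j => ?_
  have h1 := fc.fderiv_spray_eq hp j (LV p)
  have h2 := fc.spray_eq hp j
  have hE := fc.energy_smooth
  have hk : ∀ k, fderiv ℝ (pd (ey j) (pd (ex k) fc.energy)) p (LV p) =
      pd (ey j) (pd (ex k) fc.energy) p := fun k => by
    rw [((fc.energy_homog.pd_ex fc.hUopen hE k).pd_ey fc.hUopen (pd_smooth fc.hUopen hE _) j)
      p hp]
    ring
  simp only [fc.g_homog _ _ p hp, hk, fc.energy_homog.pd_ex fc.hUopen hE j p hp, LV_snd,
    zero_mul, zero_add, Finset.sum_add_distrib] at h1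
  simp only [mul_sub, Finset.sum_sub_distrib]
  have h3 : ∑ i, fc.g j i p * (2 * fc.spray i p) = 2 * ∑ i, fc.g j i p * fc.spray i p := by
    rw [Finset.mul_sum]
    exact Finset.sum_congr rfl fun i _ => by ring
  rw [h3]
  linarith

lemma N_homog (i j : Fin n) : IsHomogOn fc.U 1 (fc.N i j) := by
  have h := ((fc.spray_homog j).pd_ey fc.hUopen (fc.spray_smooth j) i).congr fc.hUopen
    (fc.Ndef i j)
  norm_num at h
  exact h

lemma N_contract {p : Pt n} (hp : p ∈ fc.U) (j : Fin n) :
    ∑ i, p.2 i * fc.N i j p = 2 * fc.spray j p := by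
  rw [← (fc.spray_homog j).euler hp]
  exact Finset.sum_congr rfl fun i _ => by rw [fc.Ndef i j p hp]

lemma fderiv_spray_ey {p : Pt n} (hp : p ∈ fc.U) (i m : Fin n) :
    fderiv ℝ (fc.spray i) p (ey m) = fc.N m i p := (fc.Ndef m i p hp).symm

lemma spray_energy {p : Pt n} (hp : p ∈ fc.U) :
    2 * ∑ i, fc.spray i p * pd (ey i) fc.energy p = ∑ k, p.2 k * pd (ex k) fc.energy p := by
  have hE := fc.energy_smooth
  have h1 : ∑ j, p.2 j * (4 * ∑ i, fc.g j i p * fc.spray i p) =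
      2 * ∑ i, fc.spray i p * pd (ey i) fc.energy p := by
    calc ∑ j, p.2 j * (4 * ∑ i, fc.g j i p * fc.spray i p)
        = ∑ i, 4 * fc.spray i p * ∑ j, p.2 j * fc.g j i p := by
          simp only [Finset.mul_sum]
          rw [Finset.sum_comm]
          exact Finset.sum_congr rfl fun i _ => Finset.sum_congr rfl fun j _ => by ring
      _ = _ := by
          rw [Finset.mul_sum]
          exact Finset.sum_congr rfl fun i _ => by rw [fc.g_contract hp i]; ring
  have h2 : ∑ j, p.2 j * ∑ k, p.2 k * pd (ey j) (pd (ex k) fc.energy) p =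
      2 * ∑ k, p.2 k * pd (ex k) fc.energy p := by
    simp only [Finset.mul_sum]
    rw [Finset.sum_comm]
    refine Finset.sum_congr rfl fun k _ => ?_
    have := (fc.energy_homog.pd_ex fc.hUopen hE k).euler hp
    rw [mul_left_comm, ← this, Finset.mul_sum]
    exact Finset.sum_congr rfl fun j _ => by ring
  simp only [fc.spray_eq hp, mul_sub, Finset.sum_sub_distrib, h2] at h1
  linarith

/-- The energy is horizontally constant. -/
lemma energy_horizontal {p : Pt n} (hp : p ∈ fc.U) (m : Fin n) :
    pd (ex m) fc.energy p = ∑ i, fc.N m i p * pd (ey i) fc.energy p := by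
  have hE := fc.energy_smooth
  have hd : ∀ v, DifferentiableAt ℝ (pd v fc.energy) p := fun v =>
    differentiableAt_of_contDiffOn fc.hUopen (pd_smooth fc.hUopen hE v) hp
  have hs : ∀ k, DifferentiableAt ℝ (fun q : Pt n => q.2 k) p := fun k =>
    differentiableAt_of_contDiffOn fc.hUopen (smooth_snd_apply k) hp
  have h := congrArg (fun l => l (ey m))
    (fderiv_congr_of_eqOn fc.hUopen (fun q hq => fc.spray_energy hq) hp)
  have hd1 : DifferentiableAt ℝ (fun q => ∑ i, fc.spray i q * pd (ey i) fc.energy q) p :=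
    DifferentiableAt.fun_sum fun i _ => (fc.spray_differentiableAt hp i).mul (hd _)
  rw [fderiv_const_mul hd1, smul_apply,
    fderiv_sum_mul (fun i => fc.spray_differentiableAt hp i) (fun i => hd _),
    fderiv_sum_mul hs (fun i => hd _)] at h
  simp only [fderiv_snd_apply, smul_eq_mul, fc.fderiv_spray_ey hp, Finset.sum_add_distrib] at h
  have h1 : ∑ k, (ey m).2 k * pd (ex k) fc.energy p = pd (ex m) fc.energy p := by
    simp [ey, Pi.single_apply]
  have h2 : ∑ i, fc.spray i p * fderiv ℝ (pd (ey i) fc.energy) p (ey m) =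
      2 * ∑ i, fc.g m i p * fc.spray i p := by
    rw [Finset.mul_sum]
    refine Finset.sum_congr rfl fun i _ => ?_
    rw [fc.g_eq hp, pd]
    ring
  have h3 := fc.spray_eq hp m
  rw [h1, h2] at h
  simp only [pd] at h h3 ⊢
  linarith

/-- The fundamental tensor is parallel along the spray. -/
lemma g_parallel {p : Pt n} (hp : p ∈ fc.U) (j m : Fin n) :
    fderiv ℝ (fc.g j m) p (XI fc p) =
      ∑ i, fc.N m i p * fc.g j i p + ∑ i, fc.N j i p * fc.g i m p := by
  have hE := fc.energy_smooth
  have hU := fc.hUopen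
  have key : ∀ j m, 4 * ∑ i, fc.spray i p * pd (ey i) (fc.g j m) p
      + 4 * ∑ i, fc.N m i p * fc.g j i p =
      pd (ey j) (pd (ex m) fc.energy) p - pd (ey m) (pd (ex j) fc.energy) p
      + 2 * ∑ k, p.2 k * pd (ex k) (fc.g j m) p := by
    intro j m
    have h := fc.fderiv_spray_eq hp j (ey m)
    have h1 : ∀ i, fderiv ℝ (fc.g j i) p (ey m) = pd (ey i) (fc.g j m) p := fun i => by
      have a := fc.pd_g hp (ey m) j i
      have b := fc.pd_g hp (ey i) j m
      have hmi := pd_comm hU (pd_smooth hU hE (ey i)) hp (ey m) (ey j)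
      have him := pd_comm hU (pd_smooth hU hE (ey m)) hp (ey i) (ey j)
      have hc : pd (ey j) (pd (ey m) (pd (ey i) fc.energy)) p =
          pd (ey j) (pd (ey i) (pd (ey m) fc.energy)) p :=
        pd_congr hU (fun q hq => pd_comm hU hE hq (ey m) (ey i)) hp _
      rw [b, him, ← hc, ← hmi, ← a, pd]
    have h2 : ∀ k, fderiv ℝ (pd (ey j) (pd (ex k) fc.energy)) p (ey m) =
        2 * pd (ex k) (fc.g j m) p := fun k => by
      have a := fc.pd_g hp (ex k) j m
      have b := pd_comm hU (pd_smooth hU (pd_smooth hU hE (ex k)) (ey m)) hp (ex k) (ey j)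
      rw [a, pd_comm hU (pd_smooth hU hE (ey m)) hp (ex k) (ey j),
        pd_congr hU (fun q hq => pd_comm hU hE hq (ex k) (ey m)) hp (ey j),
        pd_comm hU (pd_smooth hU hE (ex k)) hp (ey j) (ey m), pd]
      ring
    have h3 : ∑ k, (ey m).2 k * pd (ey j) (pd (ex k) fc.energy) p =
        pd (ey j) (pd (ex m) fc.energy) p := by
      simp [ey, Pi.single_apply]
    simp only [h1, h2, fc.fderiv_spray_ey hp, Finset.sum_add_distrib, h3] at h
    have h4 : ∑ k, p.2 k * (2 * pd (ex k) (fc.g j m) p) =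
        2 * ∑ k, p.2 k * pd (ex k) (fc.g j m) p := by
      rw [Finset.mul_sum]
      exact Finset.sum_congr rfl fun i _ => by ring
    rw [h4] at h
    simp only [mul_comm (fc.spray _ p), mul_comm (fc.N m _ p)]
    change _ = _ - fderiv ℝ (pd (ex j) fc.energy) p (ey m) + _
    linarith
  have h1 := key j m
  have h2 := key m j
  have hsymm : ∀ v, pd v (fc.g m j) p = pd v (fc.g j m) p := fun v =>
    pd_congr hU (fun q hq => fc.gsymm m j q hq) hp v
  simp only [hsymm, fc.gsymm m _ p hp] at h2
  have h3 : fderiv ℝ (fc.g j m) p (XI fc p) = ∑ k, p.2 k * pd (ex k) (fc.g j m) p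
      - 2 * ∑ i, fc.spray i p * pd (ey i) (fc.g j m) p := by
    rw [fderiv_eq_sum_pd]
    simp only [XI, fc.N_contract hp, Finset.mul_sum, neg_mul, Finset.sum_neg_distrib, mul_assoc]
    ring
  linarith

end Chart

end FinslerCalculus


section SasakiMetric

open scoped ContDiff Topology

namespace Chart

/-- The fundamental tensor as a bilinear form. -/
def gL (p : Pt n) : (Fin n → ℝ) →L[ℝ] (Fin n → ℝ) →L[ℝ] ℝ :=
  ∑ i, ∑ j, fc.g i j p • (ContinuousLinearMap.proj (R := ℝ) (φ := fun _ : Fin n => ℝ) i).smulRight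
    (ContinuousLinearMap.proj (R := ℝ) (φ := fun _ : Fin n => ℝ) j)

/-- The nonlinear connection as a linear map. -/
def nL (p : Pt n) : (Fin n → ℝ) →L[ℝ] (Fin n → ℝ) :=
  ContinuousLinearMap.pi fun i => ∑ j, fc.N j i p •
    ContinuousLinearMap.proj (R := ℝ) (φ := fun _ : Fin n => ℝ) j

/-- The vertical part of a tangent vector. -/
def dl (p : Pt n) : Pt n →L[ℝ] (Fin n → ℝ) :=
  ContinuousLinearMap.snd ℝ _ _ + (fc.nL p).comp (ContinuousLinearMap.fst ℝ _ _)

/-- The Sasaki metric as a field of continuous bilinear forms. -/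
def sasaki (p : Pt n) : Pt n →L[ℝ] Pt n →L[ℝ] ℝ :=
  (fc.gL p).bilinearComp (ContinuousLinearMap.fst ℝ _ _) (ContinuousLinearMap.fst ℝ _ _)
    + (fc.gL p).bilinearComp (fc.dl p) (fc.dl p)

lemma gL_apply (p : Pt n) (v w : Fin n → ℝ) :
    fc.gL p v w = ∑ i, ∑ j, fc.g i j p * v i * w j := by
  simp [gL, sum_apply, mul_assoc]

lemma nL_apply (p : Pt n) (v : Fin n → ℝ) (i : Fin n) :
    fc.nL p v i = ∑ j, fc.N j i p * v j := by
  simp [nL, sum_apply]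

lemma dl_apply (p v : Pt n) : fc.dl p v = v.2 + fc.nL p v.1 := rfl

lemma sasaki_apply (p v w : Pt n) :
    fc.sasaki p v w = fc.gL p v.1 w.1 + fc.gL p (fc.dl p v) (fc.dl p w) := rfl

lemma Gs_eq (p v w : Pt n) : Gs fc p v w = fc.sasaki p v w := by
  have h : ∀ u i, dely fc i p u = fc.dl p u i := fun u i => by
    rw [dl_apply, Pi.add_apply, nL_apply, dely]
  simp only [Gs, sasaki_apply, gL_apply, h, ← Finset.sum_add_distrib]
  exact Finset.sum_congr rfl fun i _ => Finset.sum_congr rfl fun j _ => by ring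

lemma gL_symm {p : Pt n} (hp : p ∈ fc.U) (v w : Fin n → ℝ) : fc.gL p v w = fc.gL p w v := by
  rw [gL_apply, gL_apply, Finset.sum_comm]
  refine Finset.sum_congr rfl fun i _ => Finset.sum_congr rfl fun j _ => ?_
  rw [fc.gsymm j i p hp]
  ring

lemma gL_pos {p : Pt n} (hp : p ∈ fc.U) {v : Fin n → ℝ} (hv : v ≠ 0) : 0 < fc.gL p v v := by
  rw [gL_apply]
  exact fc.gposdef p hp v hv

lemma gL_self_nonneg {p : Pt n} (hp : p ∈ fc.U) (v : Fin n → ℝ) : 0 ≤ fc.gL p v v := by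
  rcases eq_or_ne v 0 with rfl | hv
  · simp
  · exact (fc.gL_pos hp hv).le

lemma gL_smooth : ContDiffOn ℝ ∞ fc.gL fc.U := by
  refine contDiffOn_clm_apply.2 fun v => contDiffOn_clm_apply.2 fun w => ?_
  simp only [gL_apply]
  exact ContDiffOn.sum fun i _ => ContDiffOn.sum fun j _ =>
    ((fc.gsmooth i j).mul contDiffOn_const).mul contDiffOn_const

lemma nL_smooth : ContDiffOn ℝ ∞ fc.nL fc.U := by
  refine contDiffOn_clm_apply.2 fun v => contDiffOn_pi.2 fun i => ?_
  simp only [nL_apply]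
  exact ContDiffOn.sum fun j _ => (fc.Nsmooth j i).mul contDiffOn_const

lemma dl_smooth : ContDiffOn ℝ ∞ fc.dl fc.U :=
  contDiffOn_const.add (fc.nL_smooth.clm_comp contDiffOn_const)

lemma sasaki_smooth : ContDiffOn ℝ ∞ fc.sasaki fc.U := by
  refine contDiffOn_clm_apply.2 fun v => contDiffOn_clm_apply.2 fun w => ?_
  simp only [sasaki_apply]
  exact ((fc.gL_smooth.clm_apply contDiffOn_const).clm_apply contDiffOn_const).add
    ((fc.gL_smooth.clm_apply (fc.dl_smooth.clm_apply contDiffOn_const)).clm_apply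
      (fc.dl_smooth.clm_apply contDiffOn_const))

lemma isMetricOn_sasaki : IsMetricOn fc.U fc.sasaki where
  isOpen := fc.hUopen
  smooth := fc.sasaki_smooth
  symm p hp v w := by
    rw [sasaki_apply, sasaki_apply, fc.gL_symm hp v.1, fc.gL_symm hp (fc.dl p v)]
  nondeg p hp v h := by
    have hv := h v
    rw [sasaki_apply] at hv
    have h1 := fc.gL_self_nonneg hp v.1
    have h2 := fc.gL_self_nonneg hp (fc.dl p v)
    have hz : ∀ a : Fin n → ℝ, fc.gL p a a ≤ 0 → a = 0 := fun a ha => by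
      by_contra hne
      exact (fc.gL_pos hp hne).not_ge ha
    have hv1 := hz v.1 (by linarith)
    have hv2 := hz (fc.dl p v) (by linarith)
    rw [dl_apply, hv1, map_zero, add_zero] at hv2
    exact Prod.ext hv1 hv2

lemma isKoszul_sasaki {nab : VF n → VF n → VF n} (hnab : IsLeviCivita fc nab) :
    IsKoszul fc.U fc.sasaki nab := fun X Y Z hX hY hZ p hp => by
  have h := hnab X Y Z hX hY hZ p hp
  simp only [Gs_eq, Dv] at h
  exact h

lemma gL_differentiableAt {p : Pt n} (hp : p ∈ fc.U) : DifferentiableAt ℝ fc.gL p :=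
  differentiableAt_of_contDiffOn fc.hUopen fc.gL_smooth hp

lemma nL_differentiableAt {p : Pt n} (hp : p ∈ fc.U) : DifferentiableAt ℝ fc.nL p :=
  differentiableAt_of_contDiffOn fc.hUopen fc.nL_smooth hp

lemma fderiv_gL_apply {p : Pt n} (hp : p ∈ fc.U) (u : Pt n) (v w : Fin n → ℝ) :
    fderiv ℝ fc.gL p u v w = ∑ i, ∑ j, fderiv ℝ (fc.g i j) p u * v i * w j := by
  have h1 := ((fc.gL_differentiableAt hp).hasFDerivAt.clm_apply
    (hasFDerivAt_const v p)).clm_apply (hasFDerivAt_const w p)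
  have h2 : HasFDerivAt (fun q => ∑ i, ∑ j, fc.g i j q * v i * w j) _ p :=
    HasFDerivAt.fun_sum fun i _ => HasFDerivAt.fun_sum fun j _ =>
      ((fc.g_differentiableAt hp i j).hasFDerivAt.mul_const (v i)).mul_const (w j)
  have h := congrArg (fun l => l u) (h1.unique
    (h2.congr_of_eventuallyEq (.of_forall fun q => fc.gL_apply q v w)))
  simp [sum_apply] at h
  rw [h]
  exact Finset.sum_congr rfl fun i _ => Finset.sum_congr rfl fun j _ => by ring

lemma fderiv_nL_apply {p : Pt n} (hp : p ∈ fc.U) (u : Pt n) (v : Fin n → ℝ) (i : Fin n) :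
    fderiv ℝ fc.nL p u v i = ∑ j, fderiv ℝ (fc.N j i) p u * v j := by
  have h1 := hasFDerivAt_pi'.1 ((fc.nL_differentiableAt hp).hasFDerivAt.clm_apply
    (hasFDerivAt_const v p)) i
  have h2 : HasFDerivAt (fun q => ∑ j, fc.N j i q * v j) _ p :=
    HasFDerivAt.fun_sum fun j _ => (fc.N_differentiableAt hp j i).hasFDerivAt.mul_const (v j)
  have h := congrArg (fun l => l u) (h1.unique
    (h2.congr_of_eventuallyEq (.of_forall fun q => fc.nL_apply q v i)))
  simp [sum_apply] at h
  rw [h]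
  exact Finset.sum_congr rfl fun j _ => mul_comm _ _

lemma fderiv_gL_LV {p : Pt n} (hp : p ∈ fc.U) : fderiv ℝ fc.gL p (LV p) = 0 := by
  ext1 v
  ext1 w
  rw [fc.fderiv_gL_apply hp]
  simp [fc.g_homog _ _ p hp]

lemma fderiv_nL_LV {p : Pt n} (hp : p ∈ fc.U) : fderiv ℝ fc.nL p (LV p) = fc.nL p := by
  ext1 v
  funext i
  rw [fc.fderiv_nL_apply hp, nL_apply]
  simp [fc.N_homog _ _ p hp]

lemma fderiv_gL_XI {p : Pt n} (hp : p ∈ fc.U) (v w : Fin n → ℝ) :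
    fderiv ℝ fc.gL p (XI fc p) v w = fc.gL p (fc.nL p v) w + fc.gL p v (fc.nL p w) := by
  rw [fc.fderiv_gL_apply hp, gL_apply, gL_apply]
  simp only [fc.g_parallel hp, nL_apply, add_mul, Finset.sum_add_distrib, Finset.mul_sum,
    Finset.sum_mul]
  rw [add_comm]
  congr 1
  · rw [Finset.sum_comm_cycle]
    refine Finset.sum_congr rfl fun i _ => ?_
    rw [Finset.sum_comm]
    refine Finset.sum_congr rfl fun j _ => Finset.sum_congr rfl fun k _ => ?_
    ring
  · refine Finset.sum_congr rfl fun i _ => ?_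
    rw [Finset.sum_comm]
    refine Finset.sum_congr rfl fun j _ => Finset.sum_congr rfl fun k _ => ?_
    ring

lemma gL_snd {p : Pt n} (hp : p ∈ fc.U) (v : Fin n → ℝ) :
    fc.gL p p.2 v = (1 / 2) * fderiv ℝ fc.energy p (0, v) := by
  rw [gL_apply, Finset.sum_comm, fderiv_eq_sum_pd]
  simp only [Pi.zero_apply, zero_mul, Finset.sum_const_zero, zero_add, Finset.mul_sum]
  refine Finset.sum_congr rfl fun j _ => ?_
  rw [mul_left_comm, ← fc.g_contract hp j, Finset.mul_sum]
  exact Finset.sum_congr rfl fun i _ => by ring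

lemma gL_snd_snd {p : Pt n} (hp : p ∈ fc.U) : fc.gL p p.2 p.2 = fc.energy p := by
  rw [fc.gL_snd hp]
  have := fc.energy_homog p hp
  rw [LV] at this
  rw [this]
  ring

lemma fderiv_energy_horizontal {p : Pt n} (hp : p ∈ fc.U) (a : Fin n → ℝ) :
    fderiv ℝ fc.energy p (a, -fc.nL p a) = 0 := by
  rw [fderiv_eq_sum_pd]
  simp only [fc.energy_horizontal hp, Pi.neg_apply, nL_apply, neg_mul, Finset.sum_neg_distrib,
    Finset.mul_sum, Finset.sum_mul]
  rw [Finset.sum_comm, ← sub_eq_add_neg, sub_eq_zero]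
  exact Finset.sum_congr rfl fun i _ => Finset.sum_congr rfl fun j _ => by ring

lemma sasaki_LV {p : Pt n} (hp : p ∈ fc.U) (v : Pt n) :
    fc.sasaki p v (LV p) = (1 / 2) * fderiv ℝ fc.energy p v := by
  have h : v = (v.1, -fc.nL p v.1) + (0, fc.dl p v) := by
    ext <;> simp [dl_apply]
  conv_rhs => rw [h, map_add, fc.fderiv_energy_horizontal hp, zero_add, ← fc.gL_snd hp]
  rw [sasaki_apply, fc.gL_symm hp (fc.dl p v)]
  simp [LV, dl_apply]

lemma sasaki_LV_LV {p : Pt n} (hp : p ∈ fc.U) : fc.sasaki p (LV p) (LV p) = fc.energy p := by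
  rw [fc.sasaki_LV hp, fc.energy_homog p hp]
  ring

lemma sasaki_vertical (p v : Pt n) (w : Fin n → ℝ) :
    fc.sasaki p v (0, w) = fc.gL p (fc.dl p v) w := by
  simp [sasaki_apply, dl_apply]

lemma fderiv_sasaki_apply {p : Pt n} (hp : p ∈ fc.U) (u v w : Pt n) :
    fderiv ℝ fc.sasaki p u v w = fderiv ℝ fc.gL p u v.1 w.1
      + fderiv ℝ fc.gL p u (fc.dl p v) (fc.dl p w)
      + fc.gL p (fderiv ℝ fc.nL p u v.1) (fc.dl p w)
      + fc.gL p (fc.dl p v) (fderiv ℝ fc.nL p u w.1) := by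
  have hG := fc.isMetricOn_sasaki
  have h := hG.fderiv_apply (X := fun _ => v) (Y := fun _ => w) contDiffOn_const
    contDiffOn_const hp u
  have hg := (fc.gL_differentiableAt hp).hasFDerivAt
  have hd : ∀ v : Pt n, HasFDerivAt (fun q => fc.dl q v) ((fderiv ℝ fc.nL p).flip v.1) p :=
    fun v => by
      simpa [dl_apply] using
        ((fc.nL_differentiableAt hp).hasFDerivAt.clm_apply (hasFDerivAt_const v.1 p)).const_add v.2
  have h' : HasFDerivAt (fun q => fc.sasaki q v w) _ p :=
    ((hg.clm_apply (hasFDerivAt_const v.1 p)).clm_apply (hasFDerivAt_const w.1 p)).add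
      ((hg.clm_apply (hd v)).clm_apply (hd w))
  rw [h'.fderiv] at h
  simp at h
  rw [← h]
  ring

/-- The derivative of the Sasaki metric paired with the Liouville field. -/
lemma fderiv_sasaki_LV {p : Pt n} (hp : p ∈ fc.U) (u v : Pt n) :
    fderiv ℝ fc.sasaki p u v (LV p) =
      (1 / 2) * fderiv ℝ (fderiv ℝ fc.energy) p u v - fc.gL p (fc.dl p v) u.2 := by
  have h := fc.isMetricOn_sasaki.fderiv_apply (X := fun _ => v) contDiffOn_const smooth_LV hp u
  rw [fderiv_congr_of_eqOn fc.hUopen (fun q hq => fc.sasaki_LV hq v) hp, fderiv_LV,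
    sasaki_vertical, fderiv_const_apply] at h
  have hd := differentiableAt_of_contDiffOn fc.hUopen
    (pd_smooth fc.hUopen fc.energy_smooth v) hp
  change fderiv ℝ (fun q => (1 / 2) * pd v fc.energy q) p u = _ at h
  rw [fderiv_const_mul hd, smul_apply, fderiv_pd fc.hUopen fc.energy_smooth hp] at h
  simp only [zero_apply, map_zero, add_zero, smul_eq_mul] at h
  linarith

/-- The horizontal lift of a field of base vectors. -/
def hlift (a : Pt n → Fin n → ℝ) : VF n := fun p => (a p, -fc.nL p (a p))

lemma dl_hlift (a : Pt n → Fin n → ℝ) (p : Pt n) : fc.dl p (fc.hlift a p) = 0 := by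
  simp [dl_apply, hlift]

lemma hlift_smooth {a : Pt n → Fin n → ℝ} (ha : ContDiffOn ℝ ∞ a fc.U) :
    ContDiffOn ℝ ∞ (fc.hlift a) fc.U :=
  ha.prodMk (fc.nL_smooth.clm_apply ha).neg

lemma sasaki_hlift_LV {p : Pt n} (a : Pt n → Fin n → ℝ) :
    fc.sasaki p (fc.hlift a p) (LV p) = 0 := by
  rw [LV, sasaki_vertical, dl_hlift, map_zero, zero_apply]

lemma XI_eq_hlift : XI fc = fc.hlift Prod.snd := by
  funext p
  refine Prod.ext rfl (funext fun j => ?_)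
  simp [XI, hlift, nL_apply, mul_comm]

lemma hb_eq_hlift (E : Fin (n - 1) → Fin n → Pt n → ℝ) (a : Fin (n - 1)) :
    hb fc E a = fc.hlift fun p i => E a i p := by
  funext p
  refine Prod.ext (funext fun i => ?_) (funext fun j => ?_)
  · simp [hb, Jm, vb, dely, hlift]
  · simp [hb, Jm, vb, dely, hlift, nL_apply, mul_comm]

/-- The derivative of a horizontal lift. -/
lemma fderiv_hlift {a : Pt n → Fin n → ℝ} (ha : ContDiffOn ℝ ∞ a fc.U) {p : Pt n}
    (hp : p ∈ fc.U) (u : Pt n) :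
    fderiv ℝ (fc.hlift a) p u =
      (fderiv ℝ a p u, -(fderiv ℝ fc.nL p u (a p) + fc.nL p (fderiv ℝ a p u))) := by
  have hda := (differentiableAt_of_contDiffOn fc.hUopen ha hp).hasFDerivAt
  have h : HasFDerivAt (fc.hlift a) _ p :=
    hda.prodMk ((fc.nL_differentiableAt hp).hasFDerivAt.clm_apply hda).neg
  rw [h.fderiv]
  simp [add_comm]

/-- The vertical part of the bracket of horizontal lifts is given by the curvature of the
nonlinear connection. -/
lemma dl_lie_hlift {a b : Pt n → Fin n → ℝ} (ha : ContDiffOn ℝ ∞ a fc.U)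
    (hb : ContDiffOn ℝ ∞ b fc.U) {p : Pt n} (hp : p ∈ fc.U) (h : Fin n) :
    fc.dl p (lie (fc.hlift a) (fc.hlift b) p) h =
      ∑ j, ∑ k, a p j * b p k * Rc fc j k h p := by
  have hddx : ∀ (c : Pt n → Fin n → ℝ) (f : Pt n → ℝ),
      fderiv ℝ f p (fc.hlift c p) = ∑ k, c p k * Dv (ddx fc k) f p := by
    intro c f
    have : fc.hlift c p = ∑ k, c p k • ddx fc k p := by
      ext i <;> simp [hlift, ddx, Prod.fst_sum, Prod.snd_sum, Finset.sum_apply, Pi.single_apply,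
        nL_apply, mul_comm]
    rw [this]
    simp [Dv]
  have h1 : fc.dl p (lie (fc.hlift a) (fc.hlift b) p) =
      fderiv ℝ fc.nL p (fc.hlift b p) (a p) - fderiv ℝ fc.nL p (fc.hlift a p) (b p) := by
    rw [dl_apply, lie, fc.fderiv_hlift ha hp, fc.fderiv_hlift hb hp]
    simp only [Prod.fst_sub, Prod.snd_sub, map_sub]
    abel
  rw [h1, Pi.sub_apply, fc.fderiv_nL_apply hp, fc.fderiv_nL_apply hp]
  simp only [hddx, Rc, mul_sub, Finset.sum_sub_distrib, Finset.sum_mul]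
  congr 1
  · exact Finset.sum_congr rfl fun j _ => Finset.sum_congr rfl fun k _ => by ring
  · rw [Finset.sum_comm]
    exact Finset.sum_congr rfl fun j _ => Finset.sum_congr rfl fun k _ => by ring

section Connection

variable {fc} {nab nabBar : VF n → VF n → VF n} {X Y Z : VF n} {p : Pt n}

/-- The derivative of the Liouville field is the vertical projection. -/
lemma nab_LV (hnab : IsLeviCivita fc nab) (hX : ContDiffOn ℝ ∞ X fc.U) (hp : p ∈ fc.U) :
    nab X LV p = (0, fc.dl p (X p)) := by
  have hG := fc.isMetricOn_sasaki
  refine hG.eq_of_forall hp fun z => ?_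
  have h := hG.nab_apply (fc.isKoszul_sasaki hnab) hX smooth_LV hp z
  rw [hG.fderiv_symm hp _ (LV p), fc.fderiv_sasaki_LV hp, fc.fderiv_sasaki_LV hp,
    fc.fderiv_sasaki_apply hp, fc.fderiv_gL_LV hp, fc.fderiv_nL_LV hp,
    fderiv_fderiv_comm fc.hUopen fc.energy_smooth hp, fderiv_LV, hG.symm p hp (0, _),
    sasaki_vertical] at h
  rw [hG.symm p hp (0, _), sasaki_vertical]
  simp only [dl_apply, map_add, add_apply, zero_apply] at h ⊢
  have s := fc.gL_symm hp
  linarith [s z.2 (X p).2, s (fc.nL p z.1) (X p).2, s z.2 (fc.nL p (X p).1),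
    s (fc.nL p z.1) (fc.nL p (X p).1)]

lemma curv_LV (hnab : IsLeviCivita fc nab) (hX : ContDiffOn ℝ ∞ X fc.U)
    (hY : ContDiffOn ℝ ∞ Y fc.U) (hp : p ∈ fc.U) :
    curv nab X Y LV p = nab X (fun q => (0, fc.dl q (Y q))) p
      - nab Y (fun q => (0, fc.dl q (X q))) p - (0, fc.dl p (lie X Y p)) := by
  have hG := fc.isMetricOn_sasaki
  have hK := fc.isKoszul_sasaki hnab
  rw [curv, hG.nab_congr_of_eqOn hK hX (hG.nab_smooth hK hY smooth_LV)
      (fun q hq => nab_LV hnab hY hq) hp,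
    hG.nab_congr_of_eqOn hK hY (hG.nab_smooth hK hX smooth_LV)
      (fun q hq => nab_LV hnab hX hq) hp,
    nab_LV (X := lie X Y) hnab (hG.smooth_lieBracket hX hY) hp]

lemma curv_LV_horizontal (hnab : IsLeviCivita fc nab) (hX : ContDiffOn ℝ ∞ X fc.U)
    (hY : ContDiffOn ℝ ∞ Y fc.U) (hXh : ∀ q ∈ fc.U, fc.dl q (X q) = 0)
    (hYh : ∀ q ∈ fc.U, fc.dl q (Y q) = 0) (hp : p ∈ fc.U) :
    curv nab X Y LV p = -(0, fc.dl p (lie X Y p)) := by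
  have hG := fc.isMetricOn_sasaki
  have hK := fc.isKoszul_sasaki hnab
  rw [curv_LV hnab hX hY hp, hG.nab_zero hK hX (fun q hq => by rw [hYh q hq]; rfl) hp,
    hG.nab_zero hK hY (fun q hq => by rw [hXh q hq]; rfl) hp, sub_zero, zero_sub]

lemma fderiv_fst_eq_zero (hX : ContDiffOn ℝ ∞ X fc.U) (hXv : ∀ q ∈ fc.U, (X q).1 = 0)
    (hp : p ∈ fc.U) (v : Pt n) : (fderiv ℝ X p v).1 = 0 := by
  have h1 := (differentiableAt_of_contDiffOn fc.hUopen hX hp).hasFDerivAt.fst.fderiv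
  rw [fderiv_congr_of_eqOn (f' := fun _ => 0) fc.hUopen hXv hp, fderiv_const_apply] at h1
  exact (congrArg (fun l => l v) h1).symm

lemma dl_of_vertical {v : Pt n} (hv : v.1 = 0) : (0, fc.dl p v) = v := by
  rw [dl_apply, hv, map_zero, add_zero, ← hv]

lemma curv_LV_vertical (hnab : IsLeviCivita fc nab) (hX : ContDiffOn ℝ ∞ X fc.U)
    (hY : ContDiffOn ℝ ∞ Y fc.U) (hXv : ∀ q ∈ fc.U, (X q).1 = 0)
    (hYv : ∀ q ∈ fc.U, (Y q).1 = 0) (hp : p ∈ fc.U) :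
    curv nab X Y LV p = 0 := by
  have hG := fc.isMetricOn_sasaki
  have hK := fc.isKoszul_sasaki hnab
  have hlie : (lie X Y p).1 = 0 := by
    rw [lie, Prod.fst_sub, fderiv_fst_eq_zero hY hYv hp, fderiv_fst_eq_zero hX hXv hp, sub_zero]
  rw [curv_LV hnab hX hY hp,
    ← hG.nab_congr_of_eqOn hK hX hY (fun q hq => (dl_of_vertical (hYv q hq)).symm) hp,
    ← hG.nab_congr_of_eqOn hK hY hX (fun q hq => (dl_of_vertical (hXv q hq)).symm) hp,
    hG.nab_sub_nab hK hX hY hp, dl_of_vertical hlie]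
  exact sub_self _

lemma XI_smooth : ContDiffOn ℝ ∞ (XI fc) fc.U := by
  rw [XI_eq_hlift]
  exact fc.hlift_smooth contDiff_snd.contDiffOn

lemma dl_XI (q : Pt n) : fc.dl q (XI fc q) = 0 := by
  rw [XI_eq_hlift, dl_hlift]

lemma fderiv_XI (hp : p ∈ fc.U) (w : Fin n → ℝ) :
    fderiv ℝ (XI fc) p (0, w) = (w, -((2 : ℝ) • fc.nL p w)) := by
  have h1 : ∀ q ∈ fc.U, XI fc q = (q.2, fun j => -(2 * fc.spray j q)) := fun q hq =>
    Prod.ext rfl (funext fun j => by simp only [XI, fc.N_contract hq])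
  have h2 : HasFDerivAt (fun q : Pt n => (q.2, fun j => -(2 * fc.spray j q))) _ p :=
    hasFDerivAt_snd.prodMk (hasFDerivAt_pi.2 fun j =>
      ((fc.spray_differentiableAt hp j).hasFDerivAt.const_mul 2).neg)
  rw [fderiv_congr_of_eqOn fc.hUopen h1 hp, h2.fderiv]
  refine Prod.ext rfl (funext fun j => ?_)
  have h3 : fderiv ℝ (fc.spray j) p (0, w) = fc.nL p w j := by
    rw [fderiv_eq_sum_pd, nL_apply]
    simp [fc.Ndef _ j p hp, mul_comm]
  simp [h3]

lemma dl_lie_XI (hX : ContDiffOn ℝ ∞ X fc.U) (hXv : ∀ q ∈ fc.U, (X q).1 = 0) (hp : p ∈ fc.U) :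
    fc.dl p (lie X (XI fc) p) = -fc.nL p (X p).2 - (fderiv ℝ X p (XI fc p)).2 := by
  have h : X p = (0, (X p).2) := Prod.ext (hXv p hp) rfl
  have h' := fderiv_XI hp (X p).2
  rw [← h] at h'
  rw [lie, h', dl_apply, Prod.snd_sub, Prod.fst_sub, fderiv_fst_eq_zero hX hXv hp, sub_zero]
  module

lemma curv_LV_XI (hnab : IsLeviCivita fc nab) (hX : ContDiffOn ℝ ∞ X fc.U)
    (hXv : ∀ q ∈ fc.U, (X q).1 = 0) (hp : p ∈ fc.U) :
    curv nab X (XI fc) LV p =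
      (0, fc.nL p (X p).2 + (fderiv ℝ X p (XI fc p)).2) - nab (XI fc) X p := by
  have hG := fc.isMetricOn_sasaki
  have hK := fc.isKoszul_sasaki hnab
  have h0 : ∀ q ∈ fc.U, ((0, fc.dl q (XI fc q)) : Pt n) = 0 := fun q _ => by rw [dl_XI]; rfl
  rw [curv_LV hnab hX XI_smooth hp, hG.nab_zero hK hX h0 hp,
    ← hG.nab_congr_of_eqOn hK XI_smooth hX (fun q hq => (dl_of_vertical (hXv q hq)).symm) hp,
    dl_lie_XI hX hXv hp]
  ext
  · simp
  · simp
    ring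

lemma sasaki_vertical_curv_LV_XI (hnab : IsLeviCivita fc nab) (hX : ContDiffOn ℝ ∞ X fc.U)
    (hXv : ∀ q ∈ fc.U, (X q).1 = 0) (hp : p ∈ fc.U) (w : Fin n → ℝ) :
    fc.sasaki p (0, w) (curv nab X (XI fc) LV p) = 0 := by
  have hG := fc.isMetricOn_sasaki
  have h := hG.nab_apply (fc.isKoszul_sasaki hnab) XI_smooth hX hp (0, w)
  have hXp : X p = (0, (X p).2) := Prod.ext (hXv p hp) rfl
  have hDX : fderiv ℝ X p (XI fc p) = (0, (fderiv ℝ X p (XI fc p)).2) :=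
    Prod.ext (fderiv_fst_eq_zero hX hXv hp _) rfl
  have hc : ∀ v u : Fin n → ℝ, fderiv ℝ fc.sasaki p (0, v) (XI fc p) (0, u) =
      fc.gL p (fc.nL p v) u := fun v u => by
    have h1 := hG.fderiv_apply (X := XI fc) (Y := fun _ => (0, u)) XI_smooth contDiffOn_const
      hp (0, v)
    rw [fderiv_congr_of_eqOn (f' := fun _ => 0) fc.hUopen (fun q _ => by
      rw [sasaki_vertical, dl_XI, map_zero, zero_apply]) hp, fderiv_XI hp, sasaki_vertical] at h1
    simp only [fderiv_const_apply, zero_apply, map_zero, add_zero, dl_apply, map_add, map_neg,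
      map_smul, add_apply, neg_apply, smul_apply, smul_eq_mul] at h1
    linarith
  have hx : fderiv ℝ fc.sasaki p (XI fc p) (0, (X p).2) (0, w) =
      fc.gL p (fc.nL p (X p).2) w + fc.gL p (X p).2 (fc.nL p w) := by
    rw [fc.fderiv_sasaki_apply hp, fc.fderiv_gL_XI hp, fc.fderiv_gL_XI hp]
    simp [dl_apply]
  rw [hXp, hx, hc, hc, hDX] at h
  rw [curv_LV_XI hnab hX hXv hp, map_sub, hG.symm p hp _ (nab _ _ _), sasaki_vertical]
  simp only [sasaki_vertical, dl_apply, map_zero, add_zero, map_add] at h ⊢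
  linarith [fc.gL_symm hp w (fc.nL p (X p).2), fc.gL_symm hp w (fderiv ℝ X p (XI fc p)).2,
    fc.gL_symm hp (fc.nL p w) (X p).2]

lemma sasaki_XI_curv_LV_XI (hnab : IsLeviCivita fc nab) (hX : ContDiffOn ℝ ∞ X fc.U)
    (hXv : ∀ q ∈ fc.U, (X q).1 = 0) (hp : p ∈ fc.U) (hXL : fc.sasaki p (X p) (LV p) = 0) :
    fc.sasaki p (XI fc p) (curv nab X (XI fc) LV p) = 0 := by
  have hG := fc.isMetricOn_sasaki
  have h := hG.nab_apply (fc.isKoszul_sasaki hnab) XI_smooth hX hp (XI fc p)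
  have hXp : X p = (0, (X p).2) := Prod.ext (hXv p hp) rfl
  have hDX : fderiv ℝ X p (XI fc p) = (0, (fderiv ℝ X p (XI fc p)).2) :=
    Prod.ext (fderiv_fst_eq_zero hX hXv hp _) rfl
  have hE : ∀ q ∈ fc.U, fc.sasaki q (XI fc q) (XI fc q) = fc.energy q := fun q hq => by
    rw [sasaki_apply, dl_XI, map_zero, add_zero]
    exact fc.gL_snd_snd hq
  have h1 := hG.fderiv_apply XI_smooth XI_smooth hp (X p)
  have h2 : fc.sasaki p (fderiv ℝ (XI fc) p (X p)) (XI fc p) = 0 := by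
    rw [LV, sasaki_vertical, dl_apply, hXv p hp, map_zero, add_zero] at hXL
    rw [hXp, fderiv_XI hp, sasaki_apply, dl_XI, map_zero, add_zero]
    exact hXL
  rw [fderiv_congr_of_eqOn fc.hUopen hE hp, hG.symm p hp _ (fderiv ℝ _ _ _), h2] at h1
  rw [fc.sasaki_LV hp] at hXL
  rw [hDX, hG.symm p hp (0, _), sasaki_vertical, dl_XI] at h
  rw [curv_LV_XI hnab hX hXv hp, map_sub, hG.symm p hp _ (nab _ _ _), sasaki_vertical, dl_XI]
  simp only [map_zero, zero_apply] at h ⊢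
  linarith [hG.fderiv_symm hp (XI fc p) (X p) (XI fc p)]

/-- The curvatures of the Sasaki metric and of the indicatrix bundle on tangent fields. -/
lemma curv_indicatrix (hnab : IsLeviCivita fc nab)
    (hGauss : ∀ X Y : VF n, ∀ p ∈ fc.U, fc.F p = 1 →
      nabBar X Y p = nab X Y p - projL fc (nab X Y) p)
    (hBar : ∀ X Y : VF n, ContDiffOn ℝ ∞ X fc.U → ContDiffOn ℝ ∞ Y fc.U →
      ContDiffOn ℝ ∞ (nabBar X Y) fc.U)
    (hX : ContDiffOn ℝ ∞ X fc.U) (hY : ContDiffOn ℝ ∞ Y fc.U) (hZ : ContDiffOn ℝ ∞ Z fc.U)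
    (hXL : ∀ q ∈ fc.U, fc.sasaki q (X q) (LV q) = 0)
    (hYL : ∀ q ∈ fc.U, fc.sasaki q (Y q) (LV q) = 0)
    (hZL : ∀ q ∈ fc.U, fc.sasaki q (Z q) (LV q) = 0) (hp : p ∈ fc.U) (hF : fc.F p = 1) :
    curv nab X Y Z p = curv nabBar X Y Z p
      - fc.gL p (fc.dl p (Z p)) (fc.dl p (Y p)) • (0, fc.dl p (X p))
      + fc.gL p (fc.dl p (Z p)) (fc.dl p (X p)) • (0, fc.dl p (Y p))
      - fc.sasaki p (Z p) (curv nab X Y LV p) • LV p := by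
  have hG := fc.isMetricOn_sasaki
  have hF' : ∀ q ∈ fc.U, ∀ v, fc.sasaki q v (LV q) = 0 → fderiv ℝ fc.energy q v = 0 :=
    fun q hq v hv => by
      rw [fc.sasaki_LV hq] at hv
      linarith
  have h := hG.gauss_equation (fc.isKoszul_sasaki hnab) (nabBar := nabBar)
    (S := {q | fc.F q = 1}) smooth_LV
    (fun q hq => by rw [fc.sasaki_LV_LV hq]; exact pow_pos (fc.Fpos q hq) 2)
    (fun q hq hqS => by
      rw [fc.sasaki_LV_LV hq, energy, show fc.F q = 1 from hqS, one_pow])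
    (fun q hq v hv => by
      rw [fderiv_congr_of_eqOn fc.hUopen (fun r hr => fc.sasaki_LV_LV hr) hq, hF' q hq v hv])
    (fun W hW h0 q hq hqS v hv => fc.fderiv_eq_zero_of_indicatrix hW h0 hq hqS (by
      have := hF' q hq v hv
      rw [fc.fderiv_energy hq, show fc.F q = 1 from hqS] at this
      linarith))
    (fun A B q hq hqS => by
      rw [hGauss A B q hq hqS, projL, Gs_eq, Gs_eq])
    hBar hX hY hZ hXL hYL hZL hp hF
  rw [nab_LV hnab hX hp, nab_LV hnab hY hp, sasaki_vertical, sasaki_vertical] at h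
  exact h

end Connection

end Chart

end SasakiMetric

/-- Let `∇` be the Levi-Civita connection of the Sasaki
metric `G` on `TM` with curvature `R`, and let `∇̄` be the induced Levi-Civita
connection of the restricted metric `Ḡ` on the indicatrix bundle `IM`, given
by the Gauss formula (tangential projection), with curvature `R̄`.  Then
`R(∂̄/∂̄y^a, ∂̄/∂̄y^b)∂̄/∂̄y^c = R̄(∂̄/∂̄y^a, ∂̄/∂̄y^b)∂̄/∂̄y^c
  − (1/F²) g_{bc} ∂̄/∂̄y^a + (1/F²) g_{ac} ∂̄/∂̄y^b` and
`R(δ̄/δ̄x^a, δ̄/δ̄x^b)∂̄/∂̄y^c = R̄(δ̄/δ̄x^a, δ̄/δ̄x^b)∂̄/∂̄y^c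
  + (1/F²) R_{cab} L`, where `R_{cab} = E_c^i E_a^j E_b^k R^h_{jk} g_{hi}`;
on all frame triples other than those listed in equation (9) of the paper the
two curvature tensors agree. -/
theorem curvature_indicatrix_relations {n : ℕ} (fc : Chart n)
    (E : Fin (n-1) → Fin n → Pt n → ℝ) (hE : IsAdaptedFrame fc E)
    (nab nabBar : VF n → VF n → VF n) (hnab : IsLeviCivita fc nab)
    (hGauss : ∀ X Y : VF n, ∀ p ∈ fc.U, fc.F p = 1 →
      nabBar X Y p = nab X Y p - projL fc (nab X Y) p)
    (hBarSmooth : ∀ X Y : VF n, ContDiffOn ℝ (⊤ : ℕ∞) X fc.U →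
      ContDiffOn ℝ (⊤ : ℕ∞) Y fc.U →
      ContDiffOn ℝ (⊤ : ℕ∞) (nabBar X Y) fc.U) :
    ∀ p ∈ fc.U, fc.F p = 1 → ∀ a b c : Fin (n-1),
      (curv nab (vb E a) (vb E b) (vb E c) p
        = curv nabBar (vb E a) (vb E b) (vb E c) p
          - ((1 / fc.F p ^ 2) * gb fc E p b c) • vb E a p
          + ((1 / fc.F p ^ 2) * gb fc E p a c) • vb E b p) ∧
      (curv nab (hb fc E a) (hb fc E b) (vb E c) p
        = curv nabBar (hb fc E a) (hb fc E b) (vb E c) p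
          + ((1 / fc.F p ^ 2) * Rlow fc E c a b p) • LV p) ∧
      (curv nab (hb fc E a) (hb fc E b) (hb fc E c) p
        = curv nabBar (hb fc E a) (hb fc E b) (hb fc E c) p) ∧
      (curv nab (hb fc E a) (hb fc E b) (XI fc) p
        = curv nabBar (hb fc E a) (hb fc E b) (XI fc) p) ∧
      (curv nab (vb E a) (vb E b) (hb fc E c) p
        = curv nabBar (vb E a) (vb E b) (hb fc E c) p) ∧
      (curv nab (vb E a) (vb E b) (XI fc) p
        = curv nabBar (vb E a) (vb E b) (XI fc) p) ∧
      (curv nab (hb fc E a) (XI fc) (hb fc E b) p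
        = curv nabBar (hb fc E a) (XI fc) (hb fc E b) p) ∧
      (curv nab (hb fc E a) (XI fc) (XI fc) p
        = curv nabBar (hb fc E a) (XI fc) (XI fc) p) ∧
      (curv nab (vb E a) (XI fc) (vb E b) p
        = curv nabBar (vb E a) (XI fc) (vb E b) p) ∧
      (curv nab (vb E a) (XI fc) (XI fc) p
        = curv nabBar (vb E a) (XI fc) (XI fc) p) := by
  intro p hp hF a b c
  have hG := fc.isMetricOn_sasaki
  have hEs : ∀ a, ContDiffOn ℝ (⊤ : ℕ∞) (fun p i => E a i p) fc.U :=
    fun a => contDiffOn_pi.2 (hE.1 a)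
  have hvs : ∀ a, ContDiffOn ℝ (⊤ : ℕ∞) (vb E a) fc.U := fun a => contDiffOn_const.prodMk (hEs a)
  have hvL : ∀ a, ∀ q ∈ fc.U, fc.sasaki q (vb E a q) (LV q) = 0 := fun a q hq => by
    rw [← fc.Gs_eq, hE.2.2 a q hq]
  have hvv : ∀ a, ∀ q ∈ fc.U, (vb E a q).1 = 0 := fun a q _ => rfl
  have hdv : ∀ a, fc.dl p (vb E a p) = fun i => E a i p := fun a => by
    simp [Chart.dl_apply, vb]
  have hhs : ∀ a, ContDiffOn ℝ (⊤ : ℕ∞) (hb fc E a) fc.U := fun a => by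
    rw [fc.hb_eq_hlift]
    exact fc.hlift_smooth (hEs a)
  have hhL : ∀ a, ∀ q ∈ fc.U, fc.sasaki q (hb fc E a q) (LV q) = 0 := fun a q _ => by
    rw [fc.hb_eq_hlift, fc.sasaki_hlift_LV]
  have hdh : ∀ a, ∀ q ∈ fc.U, fc.dl q (hb fc E a q) = 0 := fun a q _ => by
    rw [fc.hb_eq_hlift, fc.dl_hlift]
  have hxs : ContDiffOn ℝ (⊤ : ℕ∞) (XI fc) fc.U := Chart.XI_smooth
  have hxL : ∀ q ∈ fc.U, fc.sasaki q (XI fc q) (LV q) = 0 := fun q _ => by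
    rw [fc.XI_eq_hlift, fc.sasaki_hlift_LV]
  have hdx : ∀ q ∈ fc.U, fc.dl q (XI fc q) = 0 := fun q _ => Chart.dl_XI q
  have hgb : ∀ a b, fc.gL p (fc.dl p (vb E a p)) (fc.dl p (vb E b p)) = gb fc E p a b :=
    fun a b => by rw [hdv, hdv, fc.gL_apply, gb]
  have key := fun {X Y Z : VF n} (hX : ContDiffOn ℝ (⊤ : ℕ∞) X fc.U)
    (hY : ContDiffOn ℝ (⊤ : ℕ∞) Y fc.U) (hZ : ContDiffOn ℝ (⊤ : ℕ∞) Z fc.U) hXL hYL hZL =>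
    Chart.curv_indicatrix hnab hGauss hBarSmooth hX hY hZ hXL hYL hZL hp hF
  have horizontal : ∀ {X Y Z : VF n}, ContDiffOn ℝ (⊤ : ℕ∞) X fc.U → ContDiffOn ℝ (⊤ : ℕ∞) Y fc.U →
      ContDiffOn ℝ (⊤ : ℕ∞) Z fc.U → (∀ q ∈ fc.U, fc.sasaki q (X q) (LV q) = 0) →
      (∀ q ∈ fc.U, fc.sasaki q (Y q) (LV q) = 0) → (∀ q ∈ fc.U, fc.sasaki q (Z q) (LV q) = 0) →
      (∀ q ∈ fc.U, fc.dl q (X q) = 0) → (∀ q ∈ fc.U, fc.dl q (Y q) = 0) →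
      curv nab X Y Z p = curv nabBar X Y Z p
        + fc.gL p (fc.dl p (Z p)) (fc.dl p (lie X Y p)) • LV p :=
    fun hX hY hZ hXL hYL hZL hXh hYh => by
      rw [key hX hY hZ hXL hYL hZL, Chart.curv_LV_horizontal hnab hX hY hXh hYh hp, map_neg,
        fc.sasaki_vertical, hXh p hp, hYh p hp]
      simp
  have vertical : ∀ {Z : VF n}, ContDiffOn ℝ (⊤ : ℕ∞) Z fc.U →
      (∀ q ∈ fc.U, fc.sasaki q (Z q) (LV q) = 0) →
      curv nab (vb E a) (vb E b) Z p = curv nabBar (vb E a) (vb E b) Z p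
        - fc.gL p (fc.dl p (Z p)) (fc.dl p (vb E b p)) • vb E a p
        + fc.gL p (fc.dl p (Z p)) (fc.dl p (vb E a p)) • vb E b p := fun hZ hZL => by
      rw [key (hvs a) (hvs b) hZ (hvL a) (hvL b) hZL,
        Chart.curv_LV_vertical hnab (hvs a) (hvs b) (hvv a) (hvv b) hp, map_zero, zero_smul,
        sub_zero, Chart.dl_of_vertical (hvv a p hp), Chart.dl_of_vertical (hvv b p hp)]
  refine ⟨?_, ?_, ?_, ?_, ?_, ?_, ?_, ?_, ?_, ?_⟩
  · rw [vertical (hvs c) (hvL c), hgb, hgb, hF, ← hgb b c, ← hgb a c,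
      fc.gL_symm hp _ (fc.dl p (vb E c p)),
      fc.gL_symm hp (fc.dl p (vb E a p)), hgb, hgb]
    simp
  · rw [horizontal (hhs a) (hhs b) (hvs c) (hhL a) (hhL b) (hvL c) (hdh a) (hdh b), hF, hdv,
      fc.hb_eq_hlift, fc.hb_eq_hlift, fc.gL_symm hp, fc.gL_apply]
    congr 2
    simp only [fc.dl_lie_hlift (hEs a) (hEs b) hp, Rlow, Finset.mul_sum, Finset.sum_mul]
    rw [Finset.sum_comm]
    refine Finset.sum_congr rfl fun i _ => ?_
    rw [← Finset.sum_comm_cycle]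
    exact Finset.sum_congr rfl fun j _ => Finset.sum_congr rfl fun k _ =>
      Finset.sum_congr rfl fun h _ => by ring
  · rw [horizontal (hhs a) (hhs b) (hhs c) (hhL a) (hhL b) (hhL c) (hdh a) (hdh b), hdh c p hp]
    simp
  · rw [horizontal (hhs a) (hhs b) hxs (hhL a) (hhL b) hxL (hdh a) (hdh b), hdx p hp]
    simp
  · rw [vertical (hhs c) (hhL c), hdh c p hp]
    simp
  · rw [vertical hxs hxL, hdx p hp]
    simp
  · rw [horizontal (hhs a) hxs (hhs b) (hhL a) hxL (hhL b) (hdh a) hdx, hdh b p hp]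
    simp
  · rw [horizontal (hhs a) hxs hxs (hhL a) hxL hxL (hdh a) hdx, hdx p hp]
    simp
  · rw [key (hvs a) hxs (hvs b) (hvL a) hxL (hvL b), hdx p hp,
      show fc.sasaki p (vb E b p) _ = 0 from
        Chart.sasaki_vertical_curv_LV_XI hnab (hvs a) (hvv a) hp _]
    simp
  · rw [key (hvs a) hxs hxs (hvL a) hxL hxL, hdx p hp,
      Chart.sasaki_XI_curv_LV_XI hnab (hvs a) (hvv a) hp (hvL a p hp)]
    simp

end FinslerFoliations

end
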